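/- arXiv:2603.10589 — 3 statements merged into one kernel-verified Lean document; each statement's English description precedes it below -/
import Mathlib

section
/- Let c : ℕ ≃ ℕ be a bijection such that c ∘ S ∘ c⁻¹ is primitive recursive (where S x = x + 1). Then the following are equivalent: (1) for every function f : ℕ → ℕ, f is primitive recursive if and only if c ∘ f ∘ c⁻¹ is primitive recursive; (2) all four of the following are primitive recursive: the binary function (x, y) ↦ c (c⁻¹ x + c⁻¹ y), the binary function (x, y) ↦ c (c⁻¹ x % c⁻¹ y) (natural-number remainder, with x % 0 = x), the function x ↦ c ((c⁻¹ x)²), and the function x ↦ c (2 ^ (c⁻¹ x)). -/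
/-- Functions of finitely many of the variables `v 0, v 1, …` obtained by substitution from
variables, constants, addition, remainder by a positive modulus, squaring and `2 ^ ·`. -/
inductive El : ((ℕ → ℕ) → ℕ) → Prop
  | var (i : ℕ) : El fun v => v i
  | const (k : ℕ) : El fun _ => k
  | add {f g} : El f → El g → El fun v => f v + g v
  | mod {f g} : El f → El g → (∀ v, 0 < g v) → El fun v => f v % g v
  | sq {f} : El f → El fun v => f v ^ 2
  | exp {f} : El f → El fun v => 2 ^ f v

namespace El

variable {f g : (ℕ → ℕ) → ℕ}

theorem of_eq (hf : El f) (H : ∀ v, f v = g v) : El g := funext H ▸ hf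

theorem subst (hf : El f) {σ : (ℕ → ℕ) → ℕ → ℕ} (hσ : ∀ i, El fun v => σ v i) :
    El fun v => f (σ v) := by
  induction hf with
  | var i => exact hσ i
  | const k => exact const k
  | add _ _ ih₁ ih₂ => exact ih₁.add ih₂
  | mod _ _ hpos ih₁ ih₂ => exact ih₁.mod ih₂ fun v => hpos _
  | sq _ ih => exact ih.sq
  | exp _ ih => exact ih.exp

theorem rename (hf : El f) (ρ : ℕ → ℕ) : El fun v => f fun i => v (ρ i) :=
  hf.subst fun i => var (ρ i)

theorem exists_monotone_bound (hf : El f) : ∃ F, El F ∧ Monotone F ∧ ∀ v, f v ≤ F v := by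
  induction hf with
  | var i => exact ⟨_, var i, fun _ _ h => h i, fun _ => le_rfl⟩
  | const k => exact ⟨_, const k, fun _ _ _ => le_rfl, fun _ => le_rfl⟩
  | add _ _ ih₁ ih₂ =>
    obtain ⟨F, hF, mF, bF⟩ := ih₁
    obtain ⟨G, hG, mG, bG⟩ := ih₂
    exact ⟨_, hF.add hG, mF.add mG, fun v => Nat.add_le_add (bF v) (bG v)⟩
  | mod _ _ _ ih₁ _ =>
    obtain ⟨F, hF, mF, bF⟩ := ih₁
    exact ⟨F, hF, mF, fun v => (Nat.mod_le _ _).trans (bF v)⟩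
  | sq _ ih =>
    obtain ⟨F, hF, mF, bF⟩ := ih
    exact ⟨_, hF.sq, fun _ _ h => Nat.pow_le_pow_left (mF h) 2,
      fun v => Nat.pow_le_pow_left (bF v) 2⟩
  | exp _ ih =>
    obtain ⟨F, hF, mF, bF⟩ := ih
    exact ⟨_, hF.exp, fun _ _ h => Nat.pow_le_pow_right two_pos (mF h),
      fun v => Nat.pow_le_pow_right two_pos (bF v)⟩

theorem sub (hf : El f) (hg : El g) : El fun v => f v - g v := by
  have hP := (hf.add hg).exp
  refine (((hP.add hf).mod (hP.add hg) fun v => by positivity).mod (hP.add hf)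
    fun v => by positivity).of_eq fun v => ?_
  have hlt : f v + g v < 2 ^ (f v + g v) := Nat.lt_two_pow_self
  rcases le_or_gt (g v) (f v) with hle | hlt'
  · rw [show 2 ^ (f v + g v) + f v = (2 ^ (f v + g v) + g v) + (f v - g v) by omega,
      Nat.add_mod_left, Nat.mod_eq_of_lt (a := f v - g v) (by omega),
      Nat.mod_eq_of_lt (by omega)]
  · rw [Nat.mod_eq_of_lt (a := 2 ^ (f v + g v) + f v) (by omega), Nat.mod_self]
    omega

theorem two_mul_mul (hf : El f) (hg : El g) : El fun v => 2 * (f v * g v) :=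
  (((hf.add hg).sq.sub hf.sq).sub hg.sq).of_eq fun v => by
    rw [Nat.sub_sub]
    exact Nat.sub_eq_of_eq_add (by ring)

theorem of_two_mul (hf : El fun v => 2 * f v) : El f := by
  have hK := hf.exp
  refine ((two_mul_mul hf hK).mod (((hK.add hK).add (hK.add hK)).sub (const 1)) fun v => ?_).of_eq
    fun v => ?_
  · have : 0 < 2 ^ (2 * f v) := by positivity
    generalize 2 ^ (2 * f v) = K at *
    omega
  · have hlt : 2 * f v < 2 ^ (2 * f v) := Nat.lt_two_pow_self
    generalize 2 ^ (2 * f v) = K at *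
    obtain ⟨N, hN⟩ : ∃ N, K + K + (K + K) = N + 1 := ⟨K + K + (K + K) - 1, by omega⟩
    rw [hN, Nat.add_sub_cancel, show 2 * (2 * f v * K) = f v + N * f v by
      rw [show 2 * (2 * f v * K) = (K + K + (K + K)) * f v by ring, hN]; ring,
      Nat.add_mul_mod_self_left, Nat.mod_eq_of_lt (by omega)]

theorem mul (hf : El f) (hg : El g) : El fun v => f v * g v := of_two_mul (two_mul_mul hf hg)

theorem div (hf : El f) (hg : El g) (hpos : ∀ v, 0 < g v) : El fun v => f v / g v := by
  have hK := (hf.add (const 1)).exp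
  have hlt v : f v + 1 < 2 ^ (f v + 1) := Nat.lt_two_pow_self
  refine (((hf.mul hK).mod ((hg.mul hK).sub (const 1)) fun v => ?_).sub
    ((hf.mod hg hpos).mul hK)).of_eq fun v => ?_
  · have : 1 * (f v + 2) ≤ g v * 2 ^ (f v + 1) := Nat.mul_le_mul (hpos v) (hlt v)
    omega
  · have hlt := hlt v
    generalize 2 ^ (f v + 1) = K at *
    have hr := Nat.mod_lt (f v) (hpos v)
    have hq := Nat.div_le_self (f v) (g v)
    have hd := Nat.div_add_mod (f v) (g v)
    generalize f v / g v = q at *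
    generalize f v % g v = r at *
    obtain ⟨N, hN⟩ : ∃ N, g v * K = N + 1 := Nat.exists_eq_succ_of_ne_zero
      (Nat.mul_pos (hpos v) (by omega)).ne'
    have hrK : (r + 1) * K ≤ g v * K := Nat.mul_le_mul_right _ hr
    rw [hN, Nat.add_sub_cancel, ← hd, show (g v * q + r) * K = q + r * K + N * q by
      rw [show (g v * q + r) * K = g v * K * q + r * K by ring, hN]; ring,
      Nat.add_mul_mod_self_left, Nat.mod_eq_of_lt (by nlinarith), Nat.add_sub_cancel]

theorem pow (hf : El f) (hg : El g) : El fun v => f v ^ g v := by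
  have hK := ((hf.mul hg).add hf).add (const 1)
  have key v : f v ^ g v + f v < 2 ^ (f v * g v + f v + 1) := by
    have h1 : f v ^ g v ≤ 2 ^ (f v * g v) := by
      rw [pow_mul]; exact Nat.pow_le_pow_left Nat.lt_two_pow_self.le _
    have h2 : f v < 2 ^ f v := Nat.lt_two_pow_self
    have h3 : 2 ^ (f v * g v) ≤ 2 ^ (f v * g v + f v) := Nat.pow_le_pow_right two_pos (by omega)
    have h4 : 2 ^ (f v) ≤ 2 ^ (f v * g v + f v) := Nat.pow_le_pow_right two_pos (by omega)
    rw [pow_succ]; omega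
  refine ((hK.mul hg).exp.mod (hK.exp.sub hf) fun v => by have := key v; omega).of_eq fun v => ?_
  have key := key v
  rw [pow_mul]
  generalize 2 ^ (f v * g v + f v + 1) = K at *
  have h1 : K ≡ f v [MOD (K - f v)] :=
    ((Nat.modEq_iff_dvd' (by omega)).2 dvd_rfl).symm
  exact Eq.trans (h1.pow (g v)) (Nat.mod_eq_of_lt (by omega))

theorem sum {ι : Type*} (s : Finset ι) {F : ι → (ℕ → ℕ) → ℕ} (hF : ∀ i ∈ s, El (F i)) :
    El fun v => ∑ i ∈ s, F i v := by
  classical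
  induction s using Finset.induction_on with
  | empty => exact (const 0).of_eq fun v => by simp
  | insert a s ha ih =>
    exact ((hF a (by simp)).add (ih fun i hi => hF i (by simp [hi]))).of_eq fun v => by
      rw [Finset.sum_insert ha]

end El

theorem digit_sum_lt {X n : ℕ} {a : ℕ → ℕ} (ha : ∀ k < n, a k < X) :
    ∑ k ∈ Finset.range n, a k * X ^ k < X ^ n := by
  induction n with
  | zero => simp
  | succ n ih =>
    rw [Finset.sum_range_succ]
    have ih := ih fun k hk => ha k (hk.trans n.lt_succ_self)
    calc _ < X ^ n + a n * X ^ n := by omega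
      _ = (a n + 1) * X ^ n := by ring
      _ ≤ X * X ^ n := Nat.mul_le_mul_right _ (ha n n.lt_succ_self)
      _ = X ^ (n + 1) := by ring

theorem digit_sum_div_mod {X : ℕ} {a : ℕ → ℕ} (ha : ∀ k, a k < X) {m n : ℕ} (hmn : m < n) :
    (∑ k ∈ Finset.range n, a k * X ^ k) / X ^ m % X = a m := by
  have hX : 0 < X := (Nat.zero_le _).trans_lt (ha 0)
  obtain ⟨d, rfl⟩ := Nat.exists_eq_add_of_lt hmn
  have h : ∑ k ∈ Finset.range (m + d + 1), a k * X ^ k =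
      ∑ k ∈ Finset.range m, a k * X ^ k +
        X ^ m * (a m + X * ∑ k ∈ Finset.range d, a (m + 1 + k) * X ^ k) := by
    rw [show m + d + 1 = m + 1 + d by ring, Finset.sum_range_add, Finset.sum_range_succ, mul_add,
      ← mul_assoc, ← pow_succ, Finset.mul_sum, ← add_assoc]
    congr 1
    · ring
    · exact Finset.sum_congr rfl fun k _ => by ring
  rw [h, Nat.add_mul_div_left _ _ (by positivity), Nat.div_eq_of_lt (digit_sum_lt fun k _ => ha k),
    zero_add, Nat.add_mul_mod_self_left, Nat.mod_eq_of_lt (ha m)]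

theorem card_filter_dvd_mul {a b : ℕ} (hb : 0 < b) :
    ((Finset.range b).filter fun i => b ∣ a * i).card = Nat.gcd a b := by
  obtain ⟨g, a', b', hg, hco, rfl, rfl⟩ := Nat.exists_coprime' (m := a) (n := b)
    (Nat.gcd_pos_of_pos_right a hb)
  have hb' : 0 < b' := Nat.pos_of_mul_pos_right hb
  rw [Nat.gcd_mul_right, hco, one_mul]
  have : ((Finset.range (b' * g)).filter fun i => b' * g ∣ a' * g * i) =
      (Finset.range g).image fun j => b' * j := by
    ext i
    simp only [Finset.mem_filter, Finset.mem_range, Finset.mem_image]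
    rw [show a' * g * i = a' * i * g by ring, Nat.mul_dvd_mul_iff_right hg,
      (Nat.Coprime.symm hco).dvd_mul_left]
    constructor
    · rintro ⟨h1, j, rfl⟩
      exact ⟨j, Nat.lt_of_mul_lt_mul_left h1, rfl⟩
    · rintro ⟨j, hj, rfl⟩
      exact ⟨Nat.mul_lt_mul_of_pos_left hj hb', dvd_mul_right _ _⟩
  rw [this, Finset.card_image_of_injective _ fun i j h => Nat.eq_of_mul_eq_mul_left hb' h,
    Finset.card_range]

/-- The solutions of `a * i + b * j = a * b` with `i < b` and `j ≤ a` are counted by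
`gcd a b`; the left-hand side reads this count off a product of geometric sums. -/
theorem gcd_eq_digit {a b X : ℕ} (ha : 0 < a) (hb : 0 < b) (hX : b * (a + 1) < X) :
    (X ^ (a * b) - 1) / (X ^ a - 1) * ((X ^ (b * (a + 1)) - 1) / (X ^ b - 1)) / X ^ (a * b) % X =
      Nat.gcd a b := by
  have hX2 : 2 ≤ X := by nlinarith
  have hgeom {e : ℕ} (he : 0 < e) (n : ℕ) :
      (X ^ (e * n) - 1) / (X ^ e - 1) = ∑ i ∈ Finset.range n, X ^ (e * i) := by
    have h2 : 2 ≤ X ^ e := hX2.trans (Nat.le_self_pow he.ne' X)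
    rw [pow_mul, ← Nat.geomSum_eq h2]
    exact Finset.sum_congr rfl fun i _ => by rw [pow_mul]
  set s := Finset.range b ×ˢ Finset.range (a + 1)
  let e : ℕ × ℕ → ℕ := fun p => a * p.1 + b * p.2
  have hcard (k : ℕ) : (s.filter fun p => e p = k).card < X :=
    (Finset.card_filter_le _ _).trans_lt (by simpa [s] using hX)
  have hsum : (∑ i ∈ Finset.range b, X ^ (a * i)) * ∑ j ∈ Finset.range (a + 1), X ^ (b * j) =
      ∑ k ∈ Finset.range (2 * (a * b) + 1), (s.filter fun p => e p = k).card * X ^ k := by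
    rw [Finset.sum_mul_sum, ← Finset.sum_product',
      ← Finset.sum_fiberwise_of_maps_to (s := s) (g := e) (t := Finset.range (2 * (a * b) + 1))]
    · refine Finset.sum_congr rfl fun k _ => ?_
      rw [← smul_eq_mul, ← Finset.sum_const]
      refine Finset.sum_congr rfl fun p hp => ?_
      rw [← (Finset.mem_filter.1 hp).2, ← pow_add]
    · rintro ⟨i, j⟩ hp
      simp only [s, Finset.mem_product, Finset.mem_range] at hp
      simp only [e, Finset.mem_range]
      nlinarith [Nat.mul_le_mul_left a hp.1.le, Nat.mul_le_mul_left b (Nat.lt_succ_iff.1 hp.2)]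
  rw [hgeom ha, hgeom hb, hsum, digit_sum_div_mod hcard (by omega), ← card_filter_dvd_mul hb]
  refine Finset.card_bij (fun p _ => p.1) ?_ ?_ ?_
  · rintro ⟨i, j⟩ hp
    simp only [s, e, Finset.mem_filter, Finset.mem_product, Finset.mem_range] at hp ⊢
    exact ⟨hp.1.1, (Nat.dvd_add_left (dvd_mul_right b j)).1 (hp.2 ▸ dvd_mul_left b a)⟩
  · rintro ⟨i, j⟩ hp ⟨i', j'⟩ hp' h
    simp only [s, e, Finset.mem_filter, Finset.mem_product, Finset.mem_range] at hp hp' h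
    subst h
    exact Prod.ext rfl (Nat.eq_of_mul_eq_mul_left hb (Nat.add_left_cancel (hp.2.trans hp'.2.symm)))
  · intro i hi
    simp only [Finset.mem_filter, Finset.mem_range] at hi
    obtain ⟨h1, k, hk⟩ := hi
    have hka : k ≤ a := by
      by_contra! h
      nlinarith [Nat.mul_le_mul_left a h1.le]
    refine ⟨(i, a - k), ?_, rfl⟩
    simp only [s, e, Finset.mem_filter, Finset.mem_product, Finset.mem_range]
    refine ⟨⟨h1, by omega⟩, ?_⟩
    rw [hk, ← mul_add, Nat.add_sub_cancel' hka, mul_comm]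

/-- The number of ones in the binary expansion. -/
def bitCount (n : ℕ) : ℕ := (Nat.digits 2 n).sum

@[simp] theorem bitCount_zero : bitCount 0 = 0 := by simp [bitCount]

theorem bitCount_add_two_mul {b : ℕ} (hb : b < 2) (n : ℕ) :
    bitCount (b + 2 * n) = b + bitCount n := by
  rcases Nat.eq_zero_or_pos (b + 2 * n) with h | h
  · obtain ⟨rfl, rfl⟩ : b = 0 ∧ n = 0 := by omega
    simp
  · rw [bitCount, Nat.digits_def' one_lt_two h, List.sum_cons, bitCount]
    congr 2
    · omega
    · congr 1; omega

theorem bitCount_add_two_pow_mul {r x : ℕ} (hx : x < 2 ^ r) (y : ℕ) :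
    bitCount (x + 2 ^ r * y) = bitCount x + bitCount y := by
  induction r generalizing x with
  | zero => obtain rfl : x = 0 := by simpa using hx
            simp
  | succ r ih =>
    have hb := Nat.mod_lt x two_pos
    have hlt : x / 2 < 2 ^ r := by rw [pow_succ] at hx; omega
    have h1 := bitCount_add_two_mul hb (x / 2)
    have h2 := bitCount_add_two_mul hb (x / 2 + 2 ^ r * y)
    rw [show x % 2 + 2 * (x / 2) = x by omega] at h1
    rw [show x % 2 + 2 * (x / 2 + 2 ^ r * y) = x % 2 + 2 * (x / 2) + 2 ^ (r + 1) * y by ring,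
      show x % 2 + 2 * (x / 2) = x by omega, ih hlt] at h2
    omega

theorem bitCount_compl {u x y : ℕ} (h : x + y + 1 = 2 ^ u) : bitCount x + bitCount y = u := by
  induction u generalizing x y with
  | zero => obtain ⟨rfl, rfl⟩ : x = 0 ∧ y = 0 := by simp at h; omega
            simp
  | succ u ih =>
    rw [pow_succ] at h
    have h1 := bitCount_add_two_mul (Nat.mod_lt x two_pos) (x / 2)
    have h2 := bitCount_add_two_mul (Nat.mod_lt y two_pos) (y / 2)
    have h3 := ih (x := x / 2) (y := y / 2) (by omega)
    rw [show x % 2 + 2 * (x / 2) = x by omega] at h1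
    rw [show y % 2 + 2 * (y / 2) = y by omega] at h2
    omega

theorem bitCount_two_pow_sub_one_mul {u a : ℕ} (ha : 0 < a) (hau : a ≤ 2 ^ u) :
    bitCount ((2 ^ u - 1) * a) = u := by
  obtain ⟨x, rfl⟩ := Nat.exists_eq_succ_of_ne_zero ha.ne'
  have h : (2 ^ u - 1) * (x + 1) = (2 ^ u - 1 - x) + 2 ^ u * x := by
    obtain ⟨N, hN⟩ : ∃ N, 2 ^ u = N + 1 := ⟨2 ^ u - 1, by omega⟩
    rw [hN, Nat.add_sub_cancel]
    have : x ≤ N := by omega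
    zify [this]; ring
  rw [h, bitCount_add_two_pow_mul (by omega)]
  exact bitCount_compl (by omega)

theorem padicValNat_centralBinom (n : ℕ) : padicValNat 2 (Nat.centralBinom n) = bitCount n := by
  have h := sub_one_mul_padicValNat_choose_eq_sub_sum_digits (p := 2) (show n ≤ 2 * n by omega)
  have h2 : bitCount (2 * n) = bitCount n := by
    simpa only [zero_add] using bitCount_add_two_mul two_pos n
  rw [bitCount] at h2
  rw [h2, show 2 * n - n = n by omega] at h
  simp only [Nat.add_one_sub_one, one_mul] at h
  rw [Nat.centralBinom, h, ← bitCount]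
  omega

namespace El

variable {f g : (ℕ → ℕ) → ℕ}

theorem gcd (hf : El f) (hg : El g) (hf0 : ∀ v, 0 < f v) (hg0 : ∀ v, 0 < g v) :
    El fun v => Nat.gcd (f v) (g v) := by
  have hm := hg.mul (hf.add (const 1))
  have hX := hm.exp
  have hX2 v : 2 ≤ 2 ^ (g v * (f v + 1)) :=
    Nat.le_self_pow (Nat.mul_pos (hg0 v) (Nat.succ_pos _)).ne' 2
  have hs {k : (ℕ → ℕ) → ℕ} (hk : ∀ v, 0 < k v) v : 0 < (2 ^ (g v * (f v + 1))) ^ k v - 1 := by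
    have := (hX2 v).trans (Nat.le_self_pow (hk v).ne' _)
    omega
  exact ((((((hX.pow (hf.mul hg)).sub (const 1)).div ((hX.pow hf).sub (const 1)) (hs hf0)).mul
    (((hX.pow hm).sub (const 1)).div ((hX.pow hg).sub (const 1)) (hs hg0))).div
    (hX.pow (hf.mul hg)) fun v => by positivity).mod hX fun v => by positivity).of_eq fun v =>
      gcd_eq_digit (hf0 v) (hg0 v) Nat.lt_two_pow_self

theorem centralBinom (hf : El f) : El fun v => Nat.centralBinom (f v) := by
  have h2f := hf.add hf
  have hX := (h2f.add (const 1)).exp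
  refine ((((hX.add (const 1)).pow h2f).div (hX.pow hf) fun v => by positivity).mod hX
    fun v => by positivity).of_eq fun v => ?_
  have hlt (k : ℕ) : (f v + f v).choose k < 2 ^ (f v + f v + 1) :=
    (Nat.choose_le_two_pow _ _).trans_lt (Nat.pow_lt_pow_right one_lt_two (Nat.lt_succ_self _))
  rw [add_pow, Nat.centralBinom, two_mul]
  convert digit_sum_div_mod hlt (show f v < f v + f v + 1 by omega) using 3
  exact Finset.sum_congr rfl fun k _ => by simp [mul_comm]

theorem of_two_pow (hf : El fun v => 2 ^ f v) : El f := by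
  have hK := (hf.add (const 1))
  have hN := hK.exp.sub (const 1)
  have hpos v : 0 < 2 ^ (2 ^ f v + 1) - 1 := by
    exact Nat.sub_pos_of_lt (Nat.one_lt_two_pow (Nat.succ_ne_zero _))
  refine ((((hf.pow hK).mod (hN.mul hN) fun v => Nat.mul_pos (hpos v) (hpos v)).sub
    (const 1)).div hN hpos).of_eq fun v => ?_
  have h1 : f v < 2 ^ f v := Nat.lt_two_pow_self
  have h2 : 2 ^ f v + 1 < 2 ^ (2 ^ f v + 1) := Nat.lt_two_pow_self
  rw [← pow_mul, mul_comm, pow_mul]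
  obtain ⟨N, hN⟩ : ∃ N, 2 ^ (2 ^ f v + 1) = N + 1 := ⟨2 ^ (2 ^ f v + 1) - 1, by omega⟩
  rw [hN, Nat.add_sub_cancel]
  have hmod : (N + 1) ^ f v ≡ 1 + f v * N [MOD N * N] := by
    generalize f v = k
    induction k with
    | zero => simp [Nat.ModEq]
    | succ k ih =>
      rw [pow_succ]
      refine (ih.mul_right _).trans ?_
      rw [show (1 + k * N) * (N + 1) = 1 + (k + 1) * N + N * N * k by ring]
      simp [Nat.ModEq]
  rw [hmod, Nat.mod_eq_of_lt (by nlinarith), Nat.add_sub_cancel_left,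
    Nat.mul_div_cancel _ (by omega)]

theorem bitCount (hf : El f) : El fun v => bitCount (f v) := by
  have hC := hf.centralBinom
  refine of_two_pow ((hC.gcd hC.exp (fun v => Nat.centralBinom_pos _) fun v => by
    positivity).of_eq fun v => ?_)
  rw [← padicValNat_centralBinom]
  have h0 := (Nat.centralBinom_pos (f v)).ne'
  generalize Nat.centralBinom (f v) = m at *
  obtain ⟨k, hk, hgcd⟩ := (Nat.dvd_prime_pow Nat.prime_two).1 (Nat.gcd_dvd_right m (2 ^ m))
  refine Nat.dvd_antisymm ?_ (Nat.dvd_gcd pow_padicValNat_dvd (pow_dvd_pow 2 ?_))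
  · rw [hgcd]
    exact pow_dvd_pow 2 ((padicValNat_dvd_iff_le h0).1 (hgcd ▸ Nat.gcd_dvd_left m (2 ^ m)))
  · exact Nat.lt_two_pow_self.le.trans (Nat.le_of_dvd (Nat.pos_of_ne_zero h0) pow_padicValNat_dvd)

end El

/-- Differences of functions in `El`. -/
def ElZ (g : (ℕ → ℕ) → ℤ) : Prop := ∃ a b, El a ∧ El b ∧ ∀ v, g v = a v - b v

namespace ElZ

variable {f g : (ℕ → ℕ) → ℤ}

theorem of_eq (hf : ElZ f) (H : ∀ v, f v = g v) : ElZ g := funext H ▸ hf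

theorem of_el {a : (ℕ → ℕ) → ℕ} (ha : El a) : ElZ fun v => a v :=
  ⟨a, _, ha, .const 0, fun v => by simp⟩

theorem const (k : ℤ) : ElZ fun _ => k :=
  ⟨_, _, .const k.toNat, .const (-k).toNat, fun _ => by dsimp only; omega⟩

theorem add (hf : ElZ f) (hg : ElZ g) : ElZ fun v => f v + g v := by
  obtain ⟨a, b, ha, hb, h⟩ := hf
  obtain ⟨a', b', ha', hb', h'⟩ := hg
  exact ⟨_, _, ha.add ha', hb.add hb', fun v => by
    simp only [h, h']; push_cast; ring⟩

theorem mul (hf : ElZ f) (hg : ElZ g) : ElZ fun v => f v * g v := by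
  obtain ⟨a, b, ha, hb, h⟩ := hf
  obtain ⟨a', b', ha', hb', h'⟩ := hg
  exact ⟨_, _, (ha.mul ha').add (hb.mul hb'), (ha.mul hb').add (hb.mul ha'),
    fun v => by simp only [h, h']; push_cast; ring⟩

theorem toNat (hf : ElZ f) : El fun v => (f v).toNat := by
  obtain ⟨a, b, ha, hb, h⟩ := hf
  exact (ha.sub hb).of_eq fun v => by rw [h]; omega

theorem natAbs (hf : ElZ f) : El fun v => (f v).natAbs := by
  obtain ⟨a, b, ha, hb, h⟩ := hf
  exact ((ha.sub hb).add (hb.sub ha)).of_eq fun v => by rw [h]; omega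

end ElZ

theorem sum_pow_mul_pow_identity (d n : ℕ) {q : ℕ} (hq : 1 ≤ q) :
    (q - 1) * (∑ k ∈ Finset.range n, k ^ d * q ^ k) + 0 ^ d +
      q * ∑ e ∈ Finset.range d, d.choose e * ∑ k ∈ Finset.range n, k ^ e * q ^ k =
      n ^ d * q ^ n := by
  obtain ⟨p, rfl⟩ := Nat.exists_eq_add_of_le' hq
  induction n with
  | zero => simp
  | succ n ih =>
    have hb : (n + 1) ^ d = ∑ e ∈ Finset.range d, d.choose e * n ^ e + n ^ d := by
      rw [add_pow, Finset.sum_range_succ]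
      simp [mul_comm]
    simp only [Finset.sum_range_succ, mul_add, Finset.sum_add_distrib]
    simp only [Nat.add_sub_cancel] at ih ⊢
    have h2 : ∑ e ∈ Finset.range d, d.choose e * (n ^ e * (p + 1) ^ n) =
        (∑ e ∈ Finset.range d, d.choose e * n ^ e) * (p + 1) ^ n := by
      rw [Finset.sum_mul]
      exact Finset.sum_congr rfl fun e _ => by ring
    rw [h2, hb, pow_succ]
    linear_combination ih

theorem El.sum_pow_mul_pow {n q : (ℕ → ℕ) → ℕ} (hn : El n) (hq : El q) (hq2 : ∀ v, 2 ≤ q v)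
    (d : ℕ) : El fun v => ∑ k ∈ Finset.range (n v), k ^ d * q v ^ k := by
  induction d using Nat.strong_induction_on with
  | _ d ih =>
    have hsum := El.sum (Finset.range d) fun e he =>
      (El.const (d.choose e)).mul (ih e (Finset.mem_range.1 he))
    refine (((((hn.pow (.const d)).mul (hq.pow hn)).sub (hq.mul hsum)).sub (.const (0 ^ d))).div
      (hq.sub (.const 1)) fun v => Nat.sub_pos_of_lt (hq2 v)).of_eq fun v => ?_
    rw [← sum_pow_mul_pow_identity d (n v) (one_le_two.trans (hq2 v)), Nat.add_sub_cancel,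
      Nat.add_sub_cancel, Nat.mul_div_cancel_left _ (Nat.sub_pos_of_lt (hq2 v))]

/-- `push y v` is the assignment `y, v 0, v 1, …`. -/
def push (y : ℕ) (v : ℕ → ℕ) : ℕ → ℕ
  | 0 => y
  | i + 1 => v i

@[simp] theorem push_zero (y : ℕ) (v : ℕ → ℕ) : push y v 0 = y := rfl

@[simp] theorem push_succ (y : ℕ) (v : ℕ → ℕ) (i : ℕ) : push y v (i + 1) = v i := rfl

@[simp] theorem push_one (y : ℕ) (v : ℕ → ℕ) : push y v 1 = v 0 := rfl

@[simp] theorem push_eta (w : ℕ → ℕ) : (push (w 0) fun i => w (i + 1)) = w :=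
  funext fun i => by cases i <;> rfl

theorem push_mono {y y' : ℕ} {v v' : ℕ → ℕ} (hy : y ≤ y') (hv : v ≤ v') :
    push y v ≤ push y' v' := fun i => by
  cases i
  exacts [hy, hv _]

theorem El.comp_push {f g : (ℕ → ℕ) → ℕ} (hf : El f) (hg : El g) : El fun v => f (push (g v) v) :=
  hf.subst fun i => by
    cases i
    exacts [hg, .var _]

/-- The sum of `F` over all `z₀, …, z_{s-1} < b` put in front of an assignment, weighted with the
powers of `q` whose exponents are the numbers with base-`b` digits `z₀, …, z_{s-1}`. -/
def boxSum {R : Type*} [CommSemiring R] (b : ℕ) :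
    ℕ → R → ((ℕ → ℕ) → R) → (ℕ → ℕ) → R
  | 0, _, F => F
  | s + 1, q, F => boxSum b s (q ^ b) fun w => ∑ k ∈ Finset.range b, F (push k w) * q ^ k

/-- `w` extends the assignment `v` by `s` values below `b`. -/
def InBox (s b : ℕ) (v w : ℕ → ℕ) : Prop := (∀ i < s, w i < b) ∧ ∀ i, w (i + s) = v i

theorem InBox.push {s b k : ℕ} {v w : ℕ → ℕ} (h : InBox s b v w) (hk : k < b) :
    InBox (s + 1) b v (push k w) := by
  refine ⟨fun i hi => ?_, fun i => h.2 i⟩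
  cases i
  exacts [hk, h.1 _ (by omega)]

theorem InBox.drop_eq {s b : ℕ} {v w : ℕ → ℕ} (h : InBox s b v w) : (fun i => w (i + s)) = v :=
  funext h.2

section boxSum

variable {R : Type*} [CommSemiring R] {b s : ℕ} {v : ℕ → ℕ}

theorem boxSum_congr {q : R} {F G : (ℕ → ℕ) → R} (h : ∀ w, InBox s b v w → F w = G w) :
    boxSum b s q F v = boxSum b s q G v := by
  induction s generalizing q F G with
  | zero => exact h v ⟨fun i hi => by omega, fun i => rfl⟩
  | succ s ih =>
    refine ih fun w hw => Finset.sum_congr rfl fun k hk => ?_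
    rw [h _ (hw.push (Finset.mem_range.1 hk))]

theorem boxSum_add (q : R) (F G : (ℕ → ℕ) → R) :
    boxSum b s q (fun w => F w + G w) v = boxSum b s q F v + boxSum b s q G v := by
  induction s generalizing q F G with
  | zero => rfl
  | succ s ih => simp only [boxSum, add_mul, Finset.sum_add_distrib, ih]

theorem boxSum_mul_left (q a : R) (F : (ℕ → ℕ) → R) :
    boxSum b s q (fun w => a * F w) v = a * boxSum b s q F v := by
  induction s generalizing q F with
  | zero => rfl
  | succ s ih => simp only [boxSum, mul_assoc, ← Finset.mul_sum, ih]

theorem boxSum_one_one : boxSum b s 1 (fun _ => (1 : R)) v = b ^ s := by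
  induction s with
  | zero => simp [boxSum]
  | succ s ih =>
    have h := boxSum_mul_left (b := b) (s := s) (v := v) 1 (b : R) fun _ => 1
    simp only [mul_one] at h
    simp [boxSum, h, ih, pow_succ, mul_comm]

theorem boxSum_succ_one (F : (ℕ → ℕ) → R) :
    boxSum b (s + 1) 1 F v = ∑ y ∈ Finset.range b, boxSum b s 1 F (push y v) := by
  induction s generalizing F with
  | zero => simp [boxSum]
  | succ s ih =>
    rw [boxSum, one_pow, ih]
    simp only [boxSum, one_pow]

theorem boxSum_natCast (q : ℕ) (F : (ℕ → ℕ) → ℕ) :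
    ((boxSum b s q F v : ℕ) : R) = boxSum b s (q : R) (fun w => (F w : R)) v := by
  induction s generalizing q F with
  | zero => rfl
  | succ s ih =>
    rw [boxSum, boxSum, ih]
    push_cast
    rfl

/-- Apply `ρ` to all variables except the first `s`. -/
def liftRename (ρ : ℕ → ℕ) : ℕ → ℕ → ℕ
  | 0, i => ρ i
  | _ + 1, 0 => 0
  | s + 1, i + 1 => liftRename ρ s i + 1

theorem boxSum_rename (ρ : ℕ → ℕ) (q : R) (F : (ℕ → ℕ) → R) :
    boxSum b s q (fun w => F fun i => w (liftRename ρ s i)) v =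
      boxSum b s q F fun i => v (ρ i) := by
  induction s generalizing q F with
  | zero => rfl
  | succ s ih =>
    rw [boxSum, boxSum, ← ih]
    congr 1
    funext w
    refine Finset.sum_congr rfl fun k _ => ?_
    congr 2
    funext i
    cases i <;> rfl

theorem bitCount_sum_range {r n : ℕ} {a : ℕ → ℕ} (ha : ∀ k < n, a k < 2 ^ r) :
    bitCount (∑ k ∈ Finset.range n, a k * (2 ^ r) ^ k) =
      ∑ k ∈ Finset.range n, bitCount (a k) := by
  induction n with
  | zero => simp
  | succ n ih =>
    have ha' : ∀ k < n, a k < 2 ^ r := fun k hk => ha k (hk.trans n.lt_succ_self)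
    have hlt := digit_sum_lt ha'
    rw [← pow_mul] at hlt
    rw [Finset.sum_range_succ, Finset.sum_range_succ, ← ih ha', ← pow_mul, mul_comm (a n),
      bitCount_add_two_pow_mul hlt]

theorem bitCount_boxSum {r : ℕ} {F : (ℕ → ℕ) → ℕ} (hF : ∀ w, InBox s b v w → F w < 2 ^ r) :
    bitCount (boxSum b s (2 ^ r) F v) = boxSum b s 1 (fun w => bitCount (F w)) v := by
  induction s generalizing r F with
  | zero => rfl
  | succ s ih =>
    rw [boxSum, ← pow_mul, ih, boxSum, one_pow]
    · refine boxSum_congr fun w hw => ?_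
      rw [bitCount_sum_range fun k hk => hF _ (hw.push hk)]
      simp
    · intro w hw
      rw [pow_mul]
      exact digit_sum_lt fun k hk => hF _ (hw.push hk)

end boxSum

/-- Functions polynomial in the first `s` variables and their exponentials, with coefficients
depending on the remaining variables. -/
inductive EP (s : ℕ) : ((ℕ → ℕ) → ℤ) → Prop
  | coef {g} : ElZ g → EP s fun w => g fun i => w (i + s)
  | var (i : ℕ) : i < s → EP s fun w => w i
  | exp (i : ℕ) : i < s → EP s fun w => 2 ^ w i
  | add {f g} : EP s f → EP s g → EP s fun w => f w + g w
  | mul {f g} : EP s f → EP s g → EP s fun w => f w * g w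

/-- Sums of functions `G w * k ^ d * (2 ^ e) ^ k` with `G` in `EP s`. -/
inductive ExpMonomials (s : ℕ) : (ℕ → (ℕ → ℕ) → ℤ) → Prop
  | monomial {G} (d e : ℕ) : EP s G → ExpMonomials s fun k w => G w * k ^ d * (2 ^ e) ^ k
  | add {f g} : ExpMonomials s f → ExpMonomials s g → ExpMonomials s fun k w => f k w + g k w

theorem ExpMonomials.mul {s : ℕ} {f g : ℕ → (ℕ → ℕ) → ℤ} (hf : ExpMonomials s f)
    (hg : ExpMonomials s g) : ExpMonomials s fun k w => f k w * g k w := by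
  induction hf with
  | monomial d e hG =>
    induction hg with
    | monomial d' e' hG' =>
      convert monomial (d + d') (e + e') (hG.mul hG') using 3
      ring
    | add _ _ ih₁ ih₂ =>
      convert ih₁.add ih₂ using 3
      ring
  | add _ _ ih₁ ih₂ =>
    convert ih₁.add ih₂ using 3
    ring

namespace EP

variable {s : ℕ} {F : (ℕ → ℕ) → ℤ}

theorem expMonomials (hF : EP (s + 1) F) : ExpMonomials s fun k w => F (push k w) := by
  induction hF with
  | coef hg =>
    convert ExpMonomials.monomial 0 0 (coef hg) using 3
    simp only [pow_zero, mul_one, one_pow]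
    rfl
  | var i hi =>
    cases i with
    | zero =>
      convert ExpMonomials.monomial (s := s) 1 0 (coef (.const 1)) using 3
      simp
    | succ i =>
      convert ExpMonomials.monomial 0 0 (var i (by omega : i < s)) using 3
      simp
  | exp i hi =>
    cases i with
    | zero =>
      convert ExpMonomials.monomial (s := s) 0 1 (coef (.const 1)) using 3
      simp
    | succ i =>
      convert ExpMonomials.monomial 0 0 (exp i (by omega : i < s)) using 3
      simp
  | add _ _ ih₁ ih₂ => exact ih₁.add ih₂
  | mul _ _ ih₁ ih₂ => exact ih₁.mul ih₂

theorem elZ (hF : EP 0 F) : ElZ F := by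
  induction hF with
  | coef hg => exact hg
  | var i hi => omega
  | exp i hi => omega
  | add _ _ ih₁ ih₂ => exact ih₁.add ih₂
  | mul _ _ ih₁ ih₂ => exact ih₁.mul ih₂

theorem sum_monomials {f : ℕ → (ℕ → ℕ) → ℤ} (hf : ExpMonomials s f) {b q : (ℕ → ℕ) → ℕ}
    (hb : El b) (hq : El q) (hq2 : ∀ v, 2 ≤ q v) :
    EP s fun w => ∑ k ∈ Finset.range (b fun i => w (i + s)),
      f k w * (q fun i => w (i + s) : ℤ) ^ k := by
  induction hf with
  | monomial d e hG =>
    have h := El.sum_pow_mul_pow hb ((El.const (2 ^ e)).mul hq)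
      (fun v => (hq2 v).trans (Nat.le_mul_of_pos_left _ (by positivity))) d
    convert hG.mul (coef (s := s) (ElZ.of_el h)) using 2 with w
    push_cast
    rw [Finset.mul_sum]
    exact Finset.sum_congr rfl fun k _ => by ring
  | add _ _ ih₁ ih₂ =>
    convert ih₁.add ih₂ using 2
    rw [← Finset.sum_add_distrib]
    exact Finset.sum_congr rfl fun k _ => by ring

theorem boxSum (hF : EP s F) {b q : (ℕ → ℕ) → ℕ} (hb : El b) (hb0 : ∀ v, 0 < b v) (hq : El q)
    (hq2 : ∀ v, 2 ≤ q v) : ElZ fun v => boxSum (b v) s (q v : ℤ) F v := by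
  induction s generalizing F q with
  | zero => exact hF.elZ
  | succ s ih =>
    refine (ih (sum_monomials hF.expMonomials hb hq hq2) (hq.pow hb) fun v =>
      (hq2 v).trans (Nat.le_self_pow (hb0 v).ne' _)).of_eq fun v => ?_
    rw [_root_.boxSum]
    push_cast
    refine boxSum_congr fun w hw => ?_
    rw [hw.drop_eq]

end EP

/-- Exponential polynomials. -/
inductive EX : ((ℕ → ℕ) → ℤ) → Prop
  | const (k : ℤ) : EX fun _ => k
  | var (i : ℕ) : EX fun w => w i
  | exp (i : ℕ) : EX fun w => 2 ^ w i
  | add {f g} : EX f → EX g → EX fun w => f w + g w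
  | mul {f g} : EX f → EX g → EX fun w => f w * g w

namespace EX

variable {P Q : (ℕ → ℕ) → ℤ}

theorem rename (hP : EX P) (ρ : ℕ → ℕ) : EX fun w => P fun i => w (ρ i) := by
  induction hP with
  | const k => exact const k
  | var i => exact var _
  | exp i => exact exp _
  | add _ _ ih₁ ih₂ => exact ih₁.add ih₂
  | mul _ _ ih₁ ih₂ => exact ih₁.mul ih₂

theorem sub (hP : EX P) (hQ : EX Q) : EX fun w => P w - Q w := by
  convert hP.add ((const (-1)).mul hQ) using 2
  ring

theorem ep (hP : EX P) (s : ℕ) : EP s P := by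
  have hvar (i : ℕ) (hi : ¬ i < s) (w : ℕ → ℕ) : w (i - s + s) = w i := by
    rw [Nat.sub_add_cancel (by omega)]
  induction hP with
  | const k => exact .coef (.const k)
  | var i =>
    by_cases hi : i < s
    · exact .var i hi
    · simpa only [hvar i hi] using EP.coef (s := s) (.of_el (.var (i - s)))
  | exp i =>
    by_cases hi : i < s
    · exact .exp i hi
    · simpa [hvar i hi] using EP.coef (s := s) (.of_el (El.var (i - s)).exp)
  | add _ _ ih₁ ih₂ => exact ih₁.add ih₂
  | mul _ _ ih₁ ih₂ => exact ih₁.mul ih₂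

end EX

/-- The number of zeros of `P` among the extensions of an assignment by `s` values below `b`. -/
def zeroCount (b s : ℕ) (P : (ℕ → ℕ) → ℤ) (v : ℕ → ℕ) : ℕ :=
  boxSum b s 1 (fun w => if P w = 0 then 1 else 0) v

theorem El.card_box_zeros {P : (ℕ → ℕ) → ℤ} (hP : EX P) (s : ℕ) {b : (ℕ → ℕ) → ℕ} (hb : El b)
    (hb0 : ∀ v, 0 < b v) : El fun v => zeroCount (b v) s P v := by
  obtain ⟨M, hM, mM, bM⟩ := (hP.ep 0).elZ.natAbs.exists_monotone_bound
  have hu : El fun v => M (fun i => if i < s then b v else v (i - s)) ^ 2 + 1 :=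
    (hM.subst fun i => by split_ifs; exacts [hb, .var _]).sq.add (const 1)
  obtain ⟨u, hu, hPu⟩ : ∃ u, El u ∧ ∀ v, 0 < u v ∧ ∀ w, InBox s (b v) v w →
      (P w).natAbs ^ 2 ≤ 2 ^ u v := by
    refine ⟨_, hu, fun v => ⟨Nat.succ_pos _, fun w hw => ?_⟩⟩
    have hle : w ≤ fun i => if i < s then b v else v (i - s) := fun i => by
      dsimp only
      split_ifs with hi
      · exact (hw.1 i hi).le
      · rw [← hw.2, Nat.sub_add_cancel (by omega)]
    exact ((Nat.pow_le_pow_left ((bM w).trans (mM hle)) 2).trans (Nat.le_succ _)).trans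
      Nat.lt_two_pow_self.le
  have hr := (hu.add hu).exp
  have hr2 v : 2 ≤ 2 ^ (u v + u v) := Nat.le_self_pow (by have := (hPu v).1; omega) 2
  have hV := ((ElZ.of_el (hu.exp.sub (const 1))).mul
    (EP.boxSum ((hP.mul hP).ep s) hb hb0 hr hr2)).toNat.bitCount
  refine ((hb.pow (const s)).sub (hV.div hu fun v => (hPu v).1)).of_eq fun v => ?_
  obtain ⟨hu0, hPu⟩ := hPu v
  have h1 : (((2 ^ u v - 1 : ℕ) : ℤ) *
      boxSum (b v) s ((2 ^ (u v + u v) : ℕ) : ℤ) (fun w => P w * P w) v).toNat =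
      boxSum (b v) s (2 ^ (u v + u v)) (fun w => (2 ^ u v - 1) * (P w).natAbs ^ 2) v := by
    rw [boxSum_mul_left, ← Int.toNat_natCast (_ * _), Nat.cast_mul, boxSum_natCast]
    congr 3
    funext w
    rw [Nat.cast_pow, Int.natAbs_sq, _root_.sq]
  have h2 : _root_.bitCount (boxSum (b v) s (2 ^ (u v + u v))
      (fun w => (2 ^ u v - 1) * (P w).natAbs ^ 2) v) =
      u v * boxSum (b v) s 1 (fun w => if P w = 0 then 0 else 1) v := by
    rw [bitCount_boxSum, ← boxSum_mul_left]
    · refine boxSum_congr fun w hw => ?_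
      by_cases hw0 : P w = 0
      · simp [hw0]
      · rw [bitCount_two_pow_sub_one_mul (by positivity) (hPu w hw)]
        simp [hw0]
    · intro w hw
      have := hPu w hw
      rw [pow_add]
      exact Nat.mul_lt_mul_of_lt_of_le (Nat.sub_lt (by positivity) one_pos) this (by positivity)
  have h3 := boxSum_add (b := b v) (s := s) (v := v) (1 : ℕ)
    (fun w => if P w = 0 then 1 else 0) fun w => if P w = 0 then 0 else 1
  rw [h1, h2, Nat.mul_div_cancel_left _ hu0, zeroCount]
  have h4 : (fun w => (if P w = 0 then 1 else 0) + if P w = 0 then 0 else 1) =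
      fun _ => (1 : ℕ) := by
    funext w
    split_ifs <;> rfl
  rw [h4, boxSum_one_one, Nat.cast_id] at h3
  omega

theorem zeroCount_succ (b s : ℕ) (P : (ℕ → ℕ) → ℤ) (v : ℕ → ℕ) :
    zeroCount b (s + 1) P v = ∑ y ∈ Finset.range b, zeroCount b s P (push y v) :=
  boxSum_succ_one _

/-- Relations with a single-fold exponential Diophantine definition in which the unknowns are
bounded by a function in `El`. -/
def SingleFold (R : (ℕ → ℕ) → Prop) : Prop :=
  ∃ s P M, EX P ∧ El M ∧ ∀ v b, zeroCount b s P v ≤ 1 ∧ (zeroCount b s P v ≠ 0 → R v) ∧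
    (R v → M v ≤ b → zeroCount b s P v = 1)

namespace SingleFold

variable {R : (ℕ → ℕ) → Prop}

theorem of_iff {R' : (ℕ → ℕ) → Prop} (hR : SingleFold R) (h : ∀ v, R v ↔ R' v) : SingleFold R' :=
  (funext fun v => propext (h v) : R = R') ▸ hR

theorem eq_zero : SingleFold fun v => v 0 = 0 := by
  refine ⟨0, _, _, .var 0, .const 0, fun v b => ?_⟩
  by_cases h : v 0 = 0 <;> simp [zeroCount, boxSum, h]

theorem rename (hR : SingleFold R) (ρ : ℕ → ℕ) : SingleFold fun v => R fun i => v (ρ i) := by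
  obtain ⟨s, P, M, hP, hM, h⟩ := hR
  refine ⟨s, _, _, hP.rename (liftRename ρ s), hM.rename ρ, fun v b => ?_⟩
  have : zeroCount b s (fun w => P fun i => w (liftRename ρ s i)) v =
      zeroCount b s P fun i => v (ρ i) := boxSum_rename ρ 1 fun w => if P w = 0 then 1 else 0
  rw [this]
  exact h _ b

theorem and_eq_zero (hR : SingleFold R) {A : (ℕ → ℕ) → ℤ} (hA : EX A) :
    SingleFold fun v => R v ∧ A v = 0 := by
  obtain ⟨s, P, M, hP, hM, h⟩ := hR
  refine ⟨s, _, M, (hP.mul hP).add ((hA.mul hA).rename (· + s)), hM, fun v b => ?_⟩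
  have : zeroCount b s (fun w => P w * P w + A (fun i => w (i + s)) * A fun i => w (i + s)) v =
      (if A v = 0 then 1 else 0) * zeroCount b s P v := by
    rw [zeroCount, zeroCount, ← boxSum_mul_left]
    refine boxSum_congr fun w hw => ?_
    simp only [hw.drop_eq, mul_self_add_mul_self_eq_zero]
    by_cases hA0 : A v = 0 <;> simp [hA0]
  rw [this]
  by_cases hA0 : A v = 0
  · simpa [hA0] using h v b
  · simp [hA0]

theorem exists_unique (hR : SingleFold R) {H : (ℕ → ℕ) → ℕ} (hH : El H)
    (huniq : ∀ v y y', R (push y v) → R (push y' v) → y = y')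
    (hbound : ∀ v y, R (push y v) → y ≤ H v) : SingleFold fun v => ∃ y, R (push y v) := by
  obtain ⟨s, P, M, hP, hM, h⟩ := hR
  obtain ⟨M', hM', mM, bM⟩ := hM.exists_monotone_bound
  refine ⟨s + 1, P, _, hP, (hM'.comp_push hH).add (hH.add (.const 1)), fun v b => ?_⟩
  rw [zeroCount_succ]
  by_cases hex : ∃ y, R (push y v)
  · obtain ⟨y, hy⟩ := hex
    have hsum : ∑ k ∈ Finset.range b, zeroCount b s P (push k v) =
        if y ∈ Finset.range b then zeroCount b s P (push y v) else 0 := by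
      rw [← Finset.sum_ite_eq' (Finset.range b) y fun k => zeroCount b s P (push k v)]
      refine Finset.sum_congr rfl fun k _ => ?_
      split_ifs with hk
      · rfl
      · by_contra hne
        exact hk (huniq v k y ((h _ b).2.1 hne) hy)
    simp only [Finset.mem_range] at hsum
    rw [hsum]
    refine ⟨?_, fun _ => ⟨y, hy⟩, fun _ hb => ?_⟩
    · split_ifs
      exacts [(h _ b).1, zero_le_one]
    · have hyH := hbound v y hy
      rw [if_pos (by omega)]
      refine (h _ b).2.2 hy (((bM _).trans (mM (push_mono hyH le_rfl))).trans ?_)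
      omega
  · have hsum : ∑ k ∈ Finset.range b, zeroCount b s P (push k v) = 0 :=
      Finset.sum_eq_zero fun k _ => by
        by_contra hne
        exact hex ⟨k, (h _ b).2.1 hne⟩
    rw [hsum]
    exact ⟨zero_le_one, fun h => absurd rfl h, fun h => absurd h hex⟩

theorem subst_of_graph (hR : SingleFold R) {h : (ℕ → ℕ) → ℕ} (hh : El h) {A : (ℕ → ℕ) → ℤ}
    (hA : EX A) (H : ∀ v y, A (push y v) = 0 ↔ y = h v) :
    SingleFold fun v => R (push (h v) v) := by
  refine ((hR.and_eq_zero hA).exists_unique hh (fun v y y' hy hy' => ?_) fun v y hy => ?_).of_iff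
    fun v => ?_
  · rw [(H v y).1 hy.2, (H v y').1 hy'.2]
  · exact ((H v y).1 hy.2).le
  · simp [H]

theorem rename_push (hR : SingleFold R) (n : ℕ) :
    SingleFold fun v => R (push (v 0) fun i => v (i + n + 1)) := by
  refine (hR.rename fun i => if i = 0 then 0 else i + n).of_iff fun v => ?_
  have : (fun i => v (if i = 0 then 0 else i + n)) = push (v 0) fun i => v (i + n + 1) := by
    funext i
    cases i
    · simp
    · simp only [push_succ, Nat.succ_ne_zero, if_false]
      congr 1; omega
  rw [this]

theorem subst_mod (hR : SingleFold R) :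
    SingleFold fun v => 0 < v 0 ∧ R (push (v 1 % v 0) fun i => v (i + 2)) := by
  have h1 := ((hR.rename_push 2).rename (· + 2)).and_eq_zero
    ((EX.var 4).sub (((EX.var 3).mul (.var 1)).add (.var 2)))
  have h2 := h1.and_eq_zero ((((EX.var 2).add (.var 0)).add (.const 1)).sub (.var 3))
  have key {v : ℕ → ℕ} {y q t : ℕ}
      (h : (v 1 : ℤ) - (v 0 * q + y) = 0 ∧ (y : ℤ) + t + 1 - v 0 = 0) :
      0 < v 0 ∧ y = v 1 % v 0 ∧ q = v 1 / v 0 ∧ t + y + 1 = v 0 := by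
    have e1 : y + v 0 * q = v 1 := by zify; linarith [h.1]
    have e2 : t + y + 1 = v 0 := by zify; linarith [h.2]
    have := (Nat.div_mod_unique (by omega : 0 < v 0)).2 ⟨e1, by omega⟩
    exact ⟨by omega, this.2.symm, this.1.symm, e2⟩
  have h3 := h2.exists_unique (El.var 2)
    (fun v t t' h h' => by
      have e : t + v 1 + 1 = v 2 := (key (v := fun i => v (i + 2)) ⟨h.1.2, h.2⟩).2.2.2
      have e' : t' + v 1 + 1 = v 2 := (key (v := fun i => v (i + 2)) ⟨h'.1.2, h'.2⟩).2.2.2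
      omega)
    (fun v t h => by
      have e : t + v 1 + 1 = v 2 := (key (v := fun i => v (i + 2)) ⟨h.1.2, h.2⟩).2.2.2
      omega)
  have h4 := h3.exists_unique (El.var 2)
    (fun v q q' ⟨t, h⟩ ⟨t', h'⟩ => by
      have e := key (v := fun i => v (i + 1)) ⟨h.1.2, h.2⟩
      have e' := key (v := fun i => v (i + 1)) ⟨h'.1.2, h'.2⟩
      exact e.2.2.1.trans e'.2.2.1.symm)
    (fun v q ⟨t, h⟩ => by
      have e := key (v := fun i => v (i + 1)) ⟨h.1.2, h.2⟩
      exact e.2.2.1.trans_le (Nat.div_le_self _ _))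
  have h5 := h4.exists_unique (El.var 1)
    (fun v y y' ⟨q, t, h⟩ ⟨q', t', h'⟩ => by
      have e := key (v := v) ⟨h.1.2, h.2⟩
      have e' := key (v := v) ⟨h'.1.2, h'.2⟩
      exact e.2.1.trans e'.2.1.symm)
    (fun v y ⟨q, t, h⟩ => by
      have e := key (v := v) ⟨h.1.2, h.2⟩
      exact e.2.1.trans_le (Nat.mod_le _ _))
  refine h5.of_iff fun v => ⟨fun ⟨y, q, t, h⟩ => ?_, fun ⟨hpos, h⟩ => ?_⟩
  · have e := key (v := v) ⟨h.1.2, h.2⟩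
    exact ⟨e.1, e.2.1 ▸ h.1.1⟩
  · refine ⟨v 1 % v 0, v 1 / v 0, v 0 - 1 - v 1 % v 0, ⟨h, ?_⟩, ?_⟩
    · have : (v 0 : ℤ) * ((v 1 / v 0 : ℕ) : ℤ) + ((v 1 % v 0 : ℕ) : ℤ) = v 1 := by
        exact_mod_cast Nat.div_add_mod (v 1) (v 0)
      change (v 1 : ℤ) - (v 0 * ((v 1 / v 0 : ℕ) : ℤ) + ((v 1 % v 0 : ℕ) : ℤ)) = 0
      linarith
    · have := Nat.mod_lt (v 1) hpos
      simp only [push_succ, push_zero]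
      omega

theorem subst (hR : SingleFold R) {f : (ℕ → ℕ) → ℕ} (hf : El f) (ρ : ℕ → ℕ) :
    SingleFold fun v => R (push (f fun i => v (ρ i)) v) := by
  induction hf generalizing ρ R with
  | var i =>
    exact hR.subst_of_graph (El.var (ρ i)) ((EX.var 0).sub (.var (ρ i + 1)))
      fun v y => by simp [sub_eq_zero]
  | const k =>
    exact hR.subst_of_graph (El.const k) ((EX.var 0).sub (.const k))
      fun v y => by simp [sub_eq_zero]
  | add _ _ ih₁ ih₂ =>
    have h := (hR.rename_push 2).subst_of_graph ((El.var 1).add (.var 0))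
      ((EX.var 0).sub ((EX.var 2).add (.var 1))) fun v y => by
        simp only [push_zero, push_succ, sub_eq_zero]
        norm_cast
    exact (ih₁ (ih₂ h fun i => ρ i + 1) ρ).of_iff fun v => Iff.rfl
  | mod _ _ hpos ih₁ ih₂ =>
    exact (ih₁ (ih₂ hR.subst_mod fun i => ρ i + 1) ρ).of_iff fun v => by simp [hpos]
  | sq _ ih =>
    have h := (hR.rename_push 1).subst_of_graph (El.var 0).sq
      ((EX.var 0).sub ((EX.var 1).mul (.var 1))) fun v y => by
        simp only [push_zero, push_one, sub_eq_zero, sq]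
        norm_cast
    exact ih h ρ
  | exp _ ih =>
    have h := (hR.rename_push 1).subst_of_graph (El.var 0).exp
      ((EX.var 0).sub (.exp 1)) fun v y => by
        simp only [push_zero, push_one, sub_eq_zero]
        norm_cast
    exact ih h ρ

end SingleFold

theorem El.card_zeros {f : ℕ → (ℕ → ℕ) → ℕ} (hf : El fun w => f (w 0) fun i => w (i + 1))
    {n : (ℕ → ℕ) → ℕ} (hn : El n) :
    El fun v => ((Finset.range (n v)).filter fun i => f i v = 0).card := by
  obtain ⟨s, P, M, hP, hM, h⟩ := SingleFold.eq_zero.subst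
    (hf.add (((El.var 0).add (.const 1)).sub (hn.rename (· + 1)))) id
  obtain ⟨M', hM', mM, bM⟩ := hM.exists_monotone_bound
  refine (El.card_box_zeros hP (s + 1) (((hM'.comp_push hn).add hn).add (.const 1))
    fun v => Nat.succ_pos _).of_eq fun v => ?_
  rw [zeroCount_succ]
  generalize hb : M' (push (n v) v) + n v + 1 = b
  have hi (i : ℕ) : zeroCount b s P (push i v) = if i < n v ∧ f i v = 0 then 1 else 0 := by
    obtain ⟨h1, h2, h3⟩ := h (push i v) b
    change _ → f i v + (i + 1 - n v) = 0 at h2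
    change f i v + (i + 1 - n v) = 0 → _ at h3
    split_ifs with hlt
    · refine h3 (by omega) ?_
      have := (bM (push i v)).trans (mM (push_mono hlt.1.le le_rfl))
      omega
    · by_contra hne
      have := h2 hne
      exact hlt (by omega)
  simp only [hi]
  rw [← Finset.card_filter]
  congr 1
  ext i
  simp only [Finset.mem_filter, Finset.mem_range]
  constructor
  · rintro ⟨-, h⟩; exact h
  · rintro h; exact ⟨by omega, h⟩

/-- Relations that are the zero sets of functions in `El`. -/
def ElP (p : (ℕ → ℕ) → Prop) : Prop := ∃ f, El f ∧ ∀ v, f v = 0 ↔ p v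

namespace ElP

variable {p q : (ℕ → ℕ) → Prop} {f g : (ℕ → ℕ) → ℕ}

theorem of_iff (hp : ElP p) (h : ∀ v, p v ↔ q v) : ElP q :=
  (funext fun v => propext (h v) : p = q) ▸ hp

theorem le (hf : El f) (hg : El g) : ElP fun v => f v ≤ g v :=
  ⟨_, hf.sub hg, fun _ => Nat.sub_eq_zero_iff_le⟩

theorem and (hp : ElP p) (hq : ElP q) : ElP fun v => p v ∧ q v := by
  obtain ⟨s, hs, hsp⟩ := hp
  obtain ⟨t, ht, htq⟩ := hq
  exact ⟨_, hs.add ht, fun v => by rw [Nat.add_eq_zero_iff, hsp, htq]⟩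

theorem not (hp : ElP p) : ElP fun v => ¬ p v := by
  obtain ⟨s, hs, hsp⟩ := hp
  exact ⟨_, (El.const 1).sub hs, fun v => by have := hsp v; dsimp only; rw [← this]; omega⟩

theorem lt (hf : El f) (hg : El g) : ElP fun v => f v < g v :=
  (le hg hf).not.of_iff fun _ => not_le

theorem eq (hf : El f) (hg : El g) : ElP fun v => f v = g v :=
  ((le hf hg).and (le hg hf)).of_iff fun _ => le_antisymm_iff.symm

theorem ite [DecidablePred p] (hp : ElP p) (hf : El f) (hg : El g) :
    El fun v => if p v then f v else g v := by
  obtain ⟨s, hs, hsp⟩ := hp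
  refine ((((El.const 1).sub hs).mul hf).add
    (((El.const 1).sub ((El.const 1).sub hs)).mul hg)).of_eq fun v => ?_
  have := hsp v
  split_ifs with h
  · simp [this.2 h]
  · have hs0 : 1 - s v = 0 := by have := mt this.1 h; omega
    simp [hs0]

theorem card {p : ℕ → (ℕ → ℕ) → Prop} [∀ v, DecidablePred fun i => p i v]
    (hp : ElP fun w => p (w 0) fun i => w (i + 1)) (hf : El f) :
    El fun v => ((Finset.range (f v)).filter fun i => p i v).card := by
  obtain ⟨s, hs, hsp⟩ := hp
  refine (El.card_zeros (f := fun i v => s (push i v)) (hs.of_eq fun v => ?_) hf).of_eq fun v => ?_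
  · rw [push_eta]
  · congr 1
    exact Finset.filter_congr fun i _ => hsp (push i v)

theorem forall_lt {p : ℕ → (ℕ → ℕ) → Prop} (hp : ElP fun w => p (w 0) fun i => w (i + 1))
    (hf : El f) : ElP fun v => ∀ i < f v, p i v := by
  classical
  refine ⟨_, (hp.not.card (p := fun i v => ¬ p i v) hf), fun v => ?_⟩
  simp [Finset.filter_eq_empty_iff]

end ElP

theorem exists_least_lt (p : ℕ → Prop) (n : ℕ) :
    ∃ k ≤ n, (∀ j < k, ¬ p j) ∧ (k < n → p k) := by
  classical
  by_cases h : ∃ j, p j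
  · rcases lt_or_ge (Nat.find h) n with hlt | hge
    · exact ⟨Nat.find h, hlt.le, fun j => Nat.find_min h, fun _ => Nat.find_spec h⟩
    · exact ⟨n, le_rfl, fun j hj => Nat.find_min h (hj.trans_le hge),
        fun h => absurd h (lt_irrefl n)⟩
  · exact ⟨n, le_rfl, fun j _ hj => h ⟨j, hj⟩, fun h => absurd h (lt_irrefl n)⟩

namespace El

variable {f g : (ℕ → ℕ) → ℕ}

theorem exists_least {p : ℕ → (ℕ → ℕ) → Prop} (hp : ElP fun w => p (w 0) fun i => w (i + 1))
    (hf : El f) :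
    ∃ m, El m ∧ ∀ v, m v ≤ f v ∧ (∀ j < m v, ¬ p j v) ∧ (m v < f v → p (m v) v) := by
  classical
  have h : ElP fun w => ∀ j < w 0 + 1, ¬ p j fun i => w (i + 1) := by
    refine ElP.forall_lt (p := fun j w => ¬ p j fun i => w (i + 1)) ?_ ((var 0).add (const 1))
    obtain ⟨s, hs, hsp⟩ := hp
    exact ElP.not ⟨_, hs.rename fun i => if i = 0 then 0 else i + 1, fun v => hsp _⟩
  refine ⟨_, h.card (p := fun i v => ∀ j < i + 1, ¬ p j v) hf, fun v => ?_⟩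
  obtain ⟨k, hk, hlt, hp⟩ := exists_least_lt (fun j => p j v) (f v)
  have : ((Finset.range (f v)).filter fun i => ∀ j < i + 1, ¬ p j v) = Finset.range k := by
    ext i
    simp only [Finset.mem_filter, Finset.mem_range]
    refine ⟨fun ⟨hi, h⟩ => ?_, fun hi => ⟨by omega, fun j hj => hlt j (by omega)⟩⟩
    by_contra! hki
    exact h k (by omega) (hp (by omega))
  rw [this, Finset.card_range]
  exact ⟨hk, hlt, hp⟩

theorem sqrt (hf : El f) : El fun v => Nat.sqrt (f v) := by
  refine (ElP.card (p := fun i v => (i + 1) * (i + 1) ≤ f v) (ElP.le (((var 0).add (const 1)).mul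
    ((var 0).add (const 1))) (hf.rename (· + 1))) hf).of_eq fun v => ?_
  convert Finset.card_range _ using 2
  ext i
  simp only [Finset.mem_filter, Finset.mem_range, ← Nat.le_sqrt]
  have := Nat.sqrt_le_self (f v)
  omega

theorem pair (hf : El f) (hg : El g) : El fun v => Nat.pair (f v) (g v) :=
  (ElP.lt hf hg).ite ((hg.mul hg).add hf) (((hf.mul hf).add hf).add hg)

theorem unpair_fst (hf : El f) : El fun v => (Nat.unpair (f v)).1 := by
  have hs := hf.sqrt
  refine ((ElP.lt (hf.sub (hs.mul hs)) hs).ite (hf.sub (hs.mul hs)) hs).of_eq fun v => ?_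
  rw [Nat.unpair]
  split_ifs <;> rfl

theorem unpair_snd (hf : El f) : El fun v => (Nat.unpair (f v)).2 := by
  have hs := hf.sqrt
  refine ((ElP.lt (hf.sub (hs.mul hs)) hs).ite hs ((hf.sub (hs.mul hs)).sub hs)).of_eq fun v => ?_
  rw [Nat.unpair]
  split_ifs <;> rfl

theorem app₂ {F : ℕ → ℕ → ℕ} (hF : El fun v => F (v 0) (v 1)) (hf : El f) (hg : El g) :
    El fun v => F (f v) (g v) :=
  hF.subst (σ := fun v i => if i = 0 then f v else g v) fun i => by
    by_cases h : i = 0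
    · simpa [h] using hf
    · simpa [h] using hg

end El

theorem Primrec₂.sum_range {f : ℕ → ℕ → ℕ} (hf : Primrec₂ f) :
    Primrec₂ fun a n => ∑ i ∈ Finset.range n, f a i := by
  refine (Primrec.nat_rec (f := fun _ : ℕ => 0) (g := fun a p => p.2 + f a p.1)
    (Primrec.const 0) (Primrec.nat_add.comp (Primrec.snd.comp Primrec.snd)
      (hf.comp Primrec.fst (Primrec.fst.comp Primrec.snd)))).of_eq fun a n => ?_
  induction n with
  | zero => rfl
  | succ n ih => rw [Finset.sum_range_succ, ← ih]

/-- `f` is the limit of a function in `El` with a primitive recursive modulus: the approximation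
at stage `b` is either undefined (coded by `0`) or correct (coded by `f x + 1`), and it is defined
from stage `β x` on. -/
def ElApprox (f : ℕ → ℕ) : Prop :=
  ∃ (F : ℕ → ℕ → ℕ) (β : ℕ → ℕ), El (fun v => F (v 0) (v 1)) ∧ Primrec β ∧
    (∀ b x, F b x ≠ 0 → F b x = f x + 1) ∧ ∀ b x, β x ≤ b → F b x = f x + 1

namespace ElApprox

variable {f g : ℕ → ℕ}

theorem of_el (hf : El fun v => f (v 1)) : ElApprox f :=
  ⟨fun _ x => f x + 1, fun _ => 0, hf.add (.const 1), .const 0, fun _ _ _ => rfl, fun _ _ _ => rfl⟩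

theorem pair (hf : ElApprox f) (hg : ElApprox g) : ElApprox fun x => Nat.pair (f x) (g x) := by
  obtain ⟨F, β, hF, hβ, hF1, hF2⟩ := hf
  obtain ⟨G, γ, hG, hγ, hG1, hG2⟩ := hg
  refine ⟨fun b x => if F b x = 0 then 0 else if G b x = 0 then 0 else
    Nat.pair (F b x - 1) (G b x - 1) + 1, fun x => β x + γ x, ?_, Primrec.nat_add.comp hβ hγ,
    fun b x h => ?_, fun b x h => ?_⟩
  · exact (ElP.eq hF (.const 0)).ite (.const 0) ((ElP.eq hG (.const 0)).ite (.const 0)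
      (((hF.sub (.const 1)).pair (hG.sub (.const 1))).add (.const 1)))
  · dsimp only at h ⊢
    split_ifs at h ⊢ with h1 h2
    · exact absurd rfl h
    · exact absurd rfl h
    rw [hF1 b x h1, hG1 b x h2]
    rfl
  · dsimp only at h ⊢
    simp [hF2 b x (by omega), hG2 b x (by omega)]

theorem comp (hf : ElApprox f) (hg : ElApprox g) (hg' : Primrec g) :
    ElApprox fun x => f (g x) := by
  obtain ⟨F, β, hF, hβ, hF1, hF2⟩ := hf
  obtain ⟨G, γ, hG, hγ, hG1, hG2⟩ := hg
  refine ⟨fun b x => if G b x = 0 then 0 else F b (G b x - 1), fun x => γ x + β (g x), ?_,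
    Primrec.nat_add.comp hγ (hβ.comp hg'), fun b x h => ?_, fun b x h => ?_⟩
  · exact (ElP.eq hG (.const 0)).ite (.const 0) (hF.app₂ (.var 0) (hG.sub (.const 1)))
  · dsimp only at h ⊢
    split_ifs at h ⊢ with h1
    · exact absurd rfl h
    rw [hG1 b x h1] at h ⊢
    exact hF1 b _ h
  · dsimp only at h ⊢
    simp [hG2 b x (by omega), hF2 b (g x) (by omega)]

theorem digit {b w i : (ℕ → ℕ) → ℕ} (hb : El b) (hw : El w) (hi : El i) :
    El fun v => w v / (2 ^ b v) ^ i v % 2 ^ b v :=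
  (hw.div (hb.exp.pow hi) fun v => by positivity).mod hb.exp fun v => by positivity

theorem prec (hf : ElApprox f) (hg : ElApprox g) (hf' : Primrec f) (hg' : Primrec g) :
    ElApprox (Nat.unpaired fun z n =>
      n.rec (f z) fun y IH => g (Nat.pair z (Nat.pair y IH))) := by
  obtain ⟨F, β, hF, hβ, hF1, hF2⟩ := hf
  obtain ⟨G, γ, hG, hγ, hG1, hG2⟩ := hg
  let s (z n : ℕ) : ℕ := n.rec (f z) fun y IH => g (Nat.pair z (Nat.pair y IH))
  let a (z n : ℕ) : ℕ := Nat.pair z (Nat.pair n (s z n))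
  have ha : Primrec₂ a := by
    have hstep : Primrec₂ fun z (q : ℕ × ℕ) => g (Nat.pair z (Nat.pair q.1 q.2)) :=
      hg'.comp (Primrec₂.natPair.comp Primrec.fst
        (Primrec₂.natPair.comp (Primrec.fst.comp Primrec.snd) (Primrec.snd.comp Primrec.snd)))
    have hs : Primrec₂ s := Primrec.nat_rec hf' hstep
    exact Primrec₂.natPair.comp Primrec.fst (Primrec₂.natPair.comp Primrec.snd hs)
  let d (b w i : ℕ) : ℕ := w / (2 ^ b) ^ i % 2 ^ b
  -- `w` codes the values of `s z` up to `n` in its base-`2 ^ b` digits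
  let p (w b x : ℕ) : Prop := d b w 0 = F b x.unpair.1 ∧ d b w 0 ≠ 0 ∧ ∀ i < x.unpair.2,
    d b w (i + 1) = G b (Nat.pair x.unpair.1 (Nat.pair i (d b w i - 1))) ∧ d b w (i + 1) ≠ 0
  have hd {b w x : ℕ} (h : p w b x) {i : ℕ} (hi : i ≤ x.unpair.2) :
      d b w i = s x.unpair.1 i + 1 := by
    induction i with
    | zero =>
      rw [h.1, hF1 _ _ (h.1 ▸ h.2.1)]
      rfl
    | succ i ih =>
      obtain ⟨h1, h2⟩ := h.2.2 i hi
      rw [ih (by omega), Nat.add_sub_cancel] at h1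
      rw [h1, hG1 _ _ (h1 ▸ h2)]
  have hp : ElP fun v => p (v 0) (v 1) (v 2) := by
    have h0 := digit (.var 1) (.var 0) (.const 0)
    have h1 := digit (.var 2) (.var 1) ((El.var 0).add (.const 1))
    refine (ElP.eq h0 (hF.app₂ (.var 1) (El.var 2).unpair_fst)).and
      ((ElP.eq h0 (.const 0)).not.and (ElP.forall_lt (p := fun i v => d (v 1) (v 0) (i + 1) =
        G (v 1) (Nat.pair (v 2).unpair.1 (Nat.pair i (d (v 1) (v 0) i - 1))) ∧
        d (v 1) (v 0) (i + 1) ≠ 0) (.and (.eq h1 (hG.app₂ (.var 2) ((El.var 3).unpair_fst.pair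
          ((El.var 0).pair ((digit (.var 2) (.var 1) (.var 0)).sub (.const 1))))))
          (ElP.eq h1 (.const 0)).not) (El.var 2).unpair_snd))
  obtain ⟨m, hm, hspec⟩ := El.exists_least (p := fun w v => p w (v 0) (v 1)) hp
    ((El.var 0).exp.pow ((El.var 1).unpair_snd.add (.const 1)))
  have hspec (b x : ℕ) := hspec (push b fun _ => x)
  refine ⟨fun b x => d b (m (push b fun _ => x)) x.unpair.2,
    fun x => β x.unpair.1 + ∑ i ∈ Finset.range (x.unpair.2 + 1),
      (γ (a x.unpair.1 i) + a x.unpair.1 i + 1), ?_, ?_, fun b x h => ?_, fun b x h => ?_⟩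
  · refine digit (.var 0) (hm.subst (σ := fun v => push (v 0) fun _ => v 1) fun i => ?_)
      (El.var 1).unpair_snd
    cases i
    exacts [.var 0, .var 1]
  · have hz : Primrec fun x : ℕ => x.unpair.1 := Primrec.fst.comp Primrec.unpair
    have hn : Primrec fun x : ℕ => x.unpair.2 := Primrec.snd.comp Primrec.unpair
    have hsum : Primrec₂ fun z i => γ (a z i) + a z i + 1 :=
      Primrec.succ.comp (Primrec.nat_add.comp (hγ.comp ha) ha)
    exact Primrec.nat_add.comp (hβ.comp hz) (hsum.sum_range.comp hz (Primrec.succ.comp hn))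
  · obtain ⟨hle, -, hlt⟩ := hspec b x
    refine hd (hlt (hle.lt_of_ne fun heq => h ?_)) le_rfl
    simp only [push_zero, push_one] at heq
    simp only [d, heq, pow_succ]
    rw [Nat.mul_div_cancel_left _ (by positivity), Nat.mod_self]
  · obtain ⟨hle, hmin, hlt⟩ := hspec b x
    have hγb {i : ℕ} (hi : i ≤ x.unpair.2) : γ (a x.unpair.1 i) + a x.unpair.1 i + 1 ≤ b := by
      refine le_trans ?_ ((Nat.le_add_left _ _).trans h)
      exact Finset.single_le_sum (f := fun i => γ (a x.unpair.1 i) + a x.unpair.1 i + 1)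
        (fun _ _ => Nat.zero_le _) (Finset.mem_range.2 (Nat.lt_succ_of_le hi))
    have hs (i : ℕ) : s x.unpair.1 (min i x.unpair.2) + 1 < 2 ^ b := by
      have h1 := hγb (min_le_right i x.unpair.2)
      have h2 : s x.unpair.1 (min i x.unpair.2) ≤ a x.unpair.1 (min i x.unpair.2) :=
        (Nat.right_le_pair _ _).trans (Nat.right_le_pair _ _)
      have h3 : b < 2 ^ b := Nat.lt_two_pow_self
      omega
    set w := ∑ k ∈ Finset.range (x.unpair.2 + 1),
      (s x.unpair.1 (min k x.unpair.2) + 1) * (2 ^ b) ^ k with hw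
    have hdw {i : ℕ} (hi : i ≤ x.unpair.2) : d b w i = s x.unpair.1 i + 1 := by
      have := digit_sum_div_mod hs (Nat.lt_succ_of_le hi)
      rwa [min_eq_left hi] at this
    have hpw : p w b x := by
      refine ⟨?_, by rw [hdw (Nat.zero_le _)]; simp, fun i hi => ⟨?_, by rw [hdw hi]; simp⟩⟩
      · rw [hdw (Nat.zero_le _), hF2 _ _ ((Nat.le_add_right _ _).trans h)]
        rfl
      · rw [hdw hi, hdw hi.le, Nat.add_sub_cancel]
        exact (hG2 b (a x.unpair.1 i) (by have := hγb hi.le; omega)).symm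
    refine hd (hlt ?_) le_rfl
    refine (not_lt.1 fun hlt => hmin w hlt hpw).trans_lt (digit_sum_lt fun k _ => hs k)

theorem of_primrec (hf : Nat.Primrec f) : ElApprox f := by
  induction hf with
  | zero => exact of_el (.const 0)
  | succ => exact of_el ((El.var 1).add (.const 1))
  | left => exact of_el (El.var 1).unpair_fst
  | right => exact of_el (El.var 1).unpair_snd
  | pair _ _ ih₁ ih₂ => exact ih₁.pair ih₂
  | comp _ hg ih₁ ih₂ => exact ih₁.comp ih₂ (Primrec.nat_iff.2 hg)
  | prec hf hg ih₁ ih₂ => exact ih₁.prec ih₂ (Primrec.nat_iff.2 hf) (Primrec.nat_iff.2 hg)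

end ElApprox

theorem exists_le_apply (c : ℕ ≃ ℕ) (n : ℕ) : ∃ i ≤ n, n ≤ c i := by
  by_contra! h
  obtain ⟨i, -, j, -, hij, heq⟩ := Finset.exists_ne_map_eq_of_card_lt_of_maps_to
    (s := Finset.range (n + 1)) (t := Finset.range n) (f := c) (by simp)
    (by
      intro i hi
      simp only [Finset.coe_range, Set.mem_Iio] at hi ⊢
      exact h i (by omega))
  exact hij (c.injective heq)

theorem primrec_of_conj_succ {c : ℕ ≃ ℕ} (h : Primrec fun x => c (c.symm x + 1)) : Primrec c :=
  (Primrec.nat_rec₁ (c 0) (h.comp Primrec.snd).to₂).of_eq fun n => by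
    induction n with
    | zero => rfl
    | succ n ih =>
      change c (c.symm (Nat.rec _ _ n) + 1) = _
      rw [ih, c.symm_apply_apply]

theorem primrec_symm_of_le {c : ℕ ≃ ℕ} (hc : Primrec c) {B : ℕ → ℕ} (hB : Primrec B)
    (h : ∀ x, c.symm x ≤ B x) : Primrec c.symm := by
  have hp : PrimrecRel fun x n => c n = x :=
    Primrec.eq.comp (hc.comp Primrec.snd) Primrec.fst
  exact Primrec.of_graph ⟨B, hB, h⟩ (hp.of_eq fun _ _ => c.eq_symm_apply.symm.trans eq_comm)

theorem primrec_symm_of_forall_primrec_conj {c : ℕ ≃ ℕ} (hc : Primrec c)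
    (h : ∀ f : ℕ → ℕ, Primrec f → Primrec fun x => c (f (c.symm x))) : Primrec c.symm := by
  have hp : PrimrecRel fun n i => n ≤ c i := Primrec.nat_le.comp Primrec.fst (hc.comp Primrec.snd)
  refine primrec_symm_of_le hc (h _ (Primrec.nat_findGreatest Primrec.id hp)) fun x => ?_
  obtain ⟨i, hi, hle⟩ := exists_le_apply c (c.symm x)
  exact Nat.findGreatest_spec (P := fun i => c.symm x ≤ c i) hi hle

theorem El.primrec_conj {c : ℕ ≃ ℕ} (hadd : Primrec₂ fun x y : ℕ => c (c.symm x + c.symm y))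
    (hmod : Primrec₂ fun x y : ℕ => c (c.symm x % c.symm y))
    (hsq : Primrec fun x => c (c.symm x ^ 2)) (hexp : Primrec fun x => c (2 ^ c.symm x))
    {f : (ℕ → ℕ) → ℕ} (hf : El f) :
    Primrec fun l : List ℕ => c (f fun i => c.symm (l.getD i 0)) := by
  induction hf with
  | var i => exact ((Primrec.list_getD 0).comp Primrec.id (Primrec.const i)).of_eq fun l => by simp
  | const k => exact Primrec.const _
  | add _ _ ih₁ ih₂ => exact (hadd.comp ih₁ ih₂).of_eq fun l => by simp
  | mod _ _ _ ih₁ ih₂ => exact (hmod.comp ih₁ ih₂).of_eq fun l => by simp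
  | sq _ ih => exact (hsq.comp ih).of_eq fun l => by simp
  | exp _ ih => exact (hexp.comp ih).of_eq fun l => by simp

/-- Up to a primitive recursive function, every number is bounded by the value of `c` at an
elementary function of that number. -/
theorem exists_el_le {c : ℕ ≃ ℕ} (hc : Primrec c) :
    ∃ (k : (ℕ → ℕ) → ℕ) (T : ℕ → ℕ), El k ∧ Primrec T ∧ ∀ v, v 0 ≤ T (c (k v)) := by
  obtain ⟨F, β, hF, hβ, hF1, hF2⟩ := ElApprox.of_primrec (Primrec.nat_iff.1 hc)
  obtain ⟨m, hm, hmspec⟩ := El.exists_least (p := fun j v => F (v 0) j = 0)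
    (.eq (hF.app₂ (.var 1) (.var 0)) (.const 0)) (.var 0)
  obtain ⟨k, hk, hkspec⟩ := El.exists_least (p := fun i v => m v ≤ F (v 0) i)
    (.le (hm.rename (· + 1)) (hF.app₂ (.var 1) (.var 0))) hm
  have hT : Primrec₂ fun _ j : ℕ => j + β j :=
    Primrec.nat_add.comp Primrec.snd (hβ.comp Primrec.snd)
  refine ⟨k, fun y => ∑ j ∈ Finset.range (y + 2), (j + β j), hk, hT.sum_range.comp (.const 0)
    (Primrec.succ.comp Primrec.succ), fun v => ?_⟩
  obtain ⟨-, hm1, hm2⟩ := hmspec v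
  obtain ⟨hk0, hk1, hk2⟩ := hkspec v
  have hv : v 0 ≤ m v + β (m v) := by
    by_contra! hlt
    have h1 := hm2 (by omega)
    have h2 := hF2 (v 0) (m v) (by omega)
    omega
  have hmk : m v ≤ c (k v) + 1 := by
    by_contra! hlt
    obtain ⟨i, hi, hci⟩ := exists_le_apply c (m v - 1)
    have hkm : k v < m v := by
      refine hk0.lt_of_ne fun heq => hk1 i (by omega) ?_
      rw [hF1 _ _ (hm1 i (by omega))]
      omega
    have := hk2 hkm
    rw [hF1 _ _ (hm1 _ hkm)] at this
    omega
  exact hv.trans (Finset.single_le_sum (f := fun j => j + β j) (fun _ _ => Nat.zero_le _)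
    (Finset.mem_range.2 (by omega)))

theorem stmt_16 (c : ℕ ≃ ℕ) (h : Primrec fun x => c (c.symm x + 1)) :
    (∀ f : ℕ → ℕ, Primrec f ↔ Primrec fun x => c (f (c.symm x))) ↔
      (Primrec₂ (fun x y : ℕ => c (c.symm x + c.symm y)) ∧
       Primrec₂ (fun x y : ℕ => c (c.symm x % c.symm y)) ∧
       Primrec (fun x => c ((c.symm x) ^ 2)) ∧
       Primrec (fun x => c (2 ^ (c.symm x)))) := by
  have hc := primrec_of_conj_succ h
  constructor
  · intro hconj
    have hs := primrec_symm_of_forall_primrec_conj hc fun f => (hconj f).1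
    have hsq : Primrec fun n : ℕ => n ^ 2 :=
      (Primrec.nat_mul.comp .id .id).of_eq fun n => (sq n).symm
    have hexp : Primrec fun n : ℕ => 2 ^ n :=
      (Primrec.nat_rec₁ 1 (Primrec.nat_mul.comp .snd (.const 2)).to₂).of_eq fun n => by
        induction n with
        | zero => rfl
        | succ n ih => rw [pow_succ, ← ih]
    exact ⟨hc.comp (Primrec.nat_add.comp (hs.comp .fst) (hs.comp .snd)),
      hc.comp (Primrec.nat_mod.comp (hs.comp .fst) (hs.comp .snd)),
      hc.comp (hsq.comp hs), hc.comp (hexp.comp hs)⟩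
  · rintro ⟨hadd, hmod, hsq, hexp⟩
    obtain ⟨k, T, hk, hT, hle⟩ := exists_el_le hc
    have hs := primrec_symm_of_le hc (hT.comp ((hk.primrec_conj hadd hmod hsq hexp).comp
      (Primrec.list_cons.comp .id (.const [])))) fun x => hle fun i => c.symm ([x].getD i 0)
    exact fun f => ⟨fun hf => hc.comp (hf.comp hs), fun hf =>
      (hs.comp (hf.comp hc)).of_eq fun n => by simp⟩
end

section
/- For all natural numbers u, v with 2 ≤ u and u < v, one has 1 / (u · (v² − 1)) < (1/2) · (1 − (log₂ u) / (log₂ v)), where log₂ denotes the base-2 logarithm of a real number and all quantities are interpreted as real numbers. -/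
theorem stmt_18 (u v : ℕ) (hu : 2 ≤ u) (huv : u < v) :
    1 / ((u : ℝ) * ((v : ℝ) ^ 2 - 1)) <
      (1 / 2) * (1 - Real.logb 2 (u : ℝ) / Real.logb 2 (v : ℝ)) := by
  have hu2 : (2 : ℝ) ≤ u := by exact_mod_cast hu
  have huv1 : (u : ℝ) + 1 ≤ v := by exact_mod_cast huv
  have hu0 : (0 : ℝ) < u := by linarith
  have hv0 : (0 : ℝ) < v := by linarith
  have hv1 : (0 : ℝ) < (v : ℝ) - 1 := by linarith
  have hlogv : 0 < Real.log v := Real.log_pos (by linarith)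
  have hlogv_le : Real.log v ≤ v - 1 := Real.log_le_sub_one_of_pos hv0
  have hdiff : 1 / (v : ℝ) ≤ Real.log v - Real.log u := by
    have h := Real.log_le_sub_one_of_pos (div_pos hu0 hv0)
    rw [Real.log_div hu0.ne' hv0.ne'] at h
    have h' : 1 / (v : ℝ) ≤ 1 - u / v := by
      rw [one_sub_div hv0.ne']
      gcongr
      linarith
    linarith
  have hratio : Real.logb 2 (u : ℝ) / Real.logb 2 (v : ℝ) = Real.log u / Real.log v :=
    div_div_div_cancel_right₀ (Real.log_pos one_lt_two).ne' _ _
  rw [hratio, one_sub_div hlogv.ne']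
  calc 1 / ((u : ℝ) * ((v : ℝ) ^ 2 - 1))
      < 1 / (2 * (v * (v - 1))) := by
        apply one_div_lt_one_div_of_lt (by positivity)
        nlinarith [mul_pos hv1 (by linarith : (0 : ℝ) < v + 1)]
    _ = (1 / 2) * (1 / v / (v - 1)) := by
        field_simp
    _ ≤ (1 / 2) * ((Real.log v - Real.log u) / Real.log v) := by
        have hnum : 0 ≤ Real.log v - Real.log u := le_trans (by positivity) hdiff
        gcongr
end

section
/- There exists a bijection c : ℕ ≃ ℕ such that c ∘ S ∘ c⁻¹ is primitive recursive (where S x = x + 1), the binary relation (x, y) ↦ (c⁻¹ x ≤ c⁻¹ y) is primitive recursive, and yet the conjugate c ∘ Pred ∘ c⁻¹ of the predecessor function (Pred 0 = 0, Pred (n+1) = n) is not primitive recursive. -/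
open Nat in
/-- Some function with a primitive recursive epigraph is not primitive recursive: the running time
of a program for the Ackermann function. -/
theorem exists_not_primrec_of_primrecRel_le : ∃ L : ℕ → ℕ,
    (∀ n, 0 < L n) ∧ PrimrecRel (fun n i => L n ≤ i) ∧ ¬ Primrec L := by
  have hcomp : Computable fun n => ack n n := computable₂_ack.comp Computable.id Computable.id
  obtain ⟨c, hc⟩ := Nat.Partrec.Code.exists_code.1 (Partrec.nat_iff.1 hcomp)
  have hspec : ∀ {k n x}, x ∈ Nat.Partrec.Code.evaln k c n → x = ack n n := by
    intro k n x hx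
    have := Nat.Partrec.Code.evaln_sound hx
    rw [hc] at this
    simpa using this
  have hex : ∀ n, ∃ k, (Nat.Partrec.Code.evaln k c n).isSome := by
    intro n
    have : ack n n ∈ Nat.Partrec.Code.eval c n := by rw [hc]; simp
    obtain ⟨k, hk⟩ := Nat.Partrec.Code.evaln_complete.1 this
    exact ⟨k, by rw [Option.mem_def.1 hk]; rfl⟩
  have heval : Primrec₂ fun n i => Nat.Partrec.Code.evaln i c n :=
    Nat.Partrec.Code.primrec_evaln.comp
      (Primrec.pair (Primrec.pair Primrec.snd (Primrec.const c)) Primrec.fst)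
  refine ⟨fun n => Nat.find (hex n), fun n => ?_, ?_, fun hL => ?_⟩
  · rw [Nat.find_pos]
    simp [Nat.Partrec.Code.evaln]
  · have : PrimrecRel fun n i => (Nat.Partrec.Code.evaln i c n).isSome = true :=
      Primrec.eq.comp (Primrec.option_isSome.comp heval) (Primrec.const true)
    refine this.of_eq fun n i => ⟨fun h => Nat.find_min' _ h, fun h => ?_⟩
    obtain ⟨x, hx⟩ := Option.isSome_iff_exists.1 (Nat.find_spec (hex n))
    exact Option.isSome_iff_exists.2 ⟨x, Nat.Partrec.Code.evaln_mono h hx⟩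
  · refine not_primrec_ack_self ((Primrec.option_getD_default.comp
      (heval.comp Primrec.id hL)).of_eq fun n => ?_)
    obtain ⟨x, hx⟩ := Option.isSome_iff_exists.1 (Nat.find_spec (hex n))
    simp only [id, hx, Option.getD_some]
    exact hspec hx

namespace SuccCopy

variable (L : ℕ → ℕ)

/-- `x` does not code a point `(n, i)` of the chain `(n, 0), …, (n, L n)`. -/
def Spare (x : ℕ) : Prop := L x.unpair.1 < x.unpair.2

instance : DecidablePred (Spare L) := fun _ => inferInstanceAs (Decidable (_ < _))

/-- The block `m` of the copy consists of the chain `(m, 0), …, (m, L m)`, with `m` itself inserted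
right after `(m, 0)` if it is spare. -/
def block (x : ℕ) : ℕ := if Spare L x then x else x.unpair.1

/-- The position of a point inside its block. -/
def offset (x : ℕ) : ℕ :=
  if Spare L x then 1 else
    if x.unpair.2 = 0 then 0 else x.unpair.2 + if Spare L x.unpair.1 then 1 else 0

/-- The number of points of a block. -/
def size (m : ℕ) : ℕ := L m + 1 + if Spare L m then 1 else 0

/-- The position of a point in the copy. -/
def rank (x : ℕ) : ℕ := ∑ m ∈ Finset.range (block L x), size L m + offset L x

/-- The successor function of the copy. -/
def next (x : ℕ) : ℕ :=
  if Spare L x then Nat.pair x 1 else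
    if x.unpair.2 = 0 ∧ Spare L x.unpair.1 then x.unpair.1 else
      if L x.unpair.1 ≤ x.unpair.2 then Nat.pair (x.unpair.1 + 1) 0 else
        Nat.pair x.unpair.1 (x.unpair.2 + 1)

variable {L}

theorem spare_pair (n i : ℕ) : Spare L (Nat.pair n i) ↔ L n < i := by simp [Spare]

theorem rank_spare {x : ℕ} (h : Spare L x) :
    rank L x = ∑ m ∈ Finset.range x, size L m + 1 := by
  simp [rank, block, offset, h]

theorem rank_pair {n i : ℕ} (h : i ≤ L n) :
    rank L (Nat.pair n i) = ∑ m ∈ Finset.range n, size L m +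
      if i = 0 then 0 else i + if Spare L n then 1 else 0 := by
  simp [rank, block, offset, spare_pair, h.not_gt]

theorem rank_next (hL : ∀ n, 0 < L n) (x : ℕ) : rank L (next L x) = rank L x + 1 := by
  by_cases hx : Spare L x
  · rw [next, if_pos hx, rank_pair (hL x), rank_spare hx]
    simp [hx]
  · obtain ⟨n, i, rfl⟩ : ∃ n i, x = Nat.pair n i := ⟨_, _, (Nat.pair_unpair x).symm⟩
    have hi : i ≤ L n := by simpa [spare_pair] using hx
    rw [next, if_neg hx, rank_pair hi]
    simp only [Nat.unpair_pair]
    have := hL n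
    by_cases h : i = 0 ∧ Spare L n
    · rw [if_pos h, rank_spare h.2, if_pos h.1]
    · rw [if_neg h]
      split_ifs
      all_goals first
        | rw [rank_pair (Nat.zero_le _), Finset.sum_range_succ, size]
          grind
        | rw [rank_pair (by omega)]
          grind

theorem offset_lt_size (hL : ∀ n, 0 < L n) (x : ℕ) : offset L x < size L (block L x) := by
  have := hL x
  have : ¬ Spare L x → x.unpair.2 ≤ L x.unpair.1 := not_lt.1
  unfold offset block size
  grind

theorem rank_lt_of_block_lt (hL : ∀ n, 0 < L n) {x y : ℕ} (h : block L x < block L y) :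
    rank L x < rank L y := by
  have h1 := offset_lt_size hL x
  have h2 : ∑ m ∈ Finset.range (block L x + 1), size L m ≤
      ∑ m ∈ Finset.range (block L y), size L m :=
    Finset.sum_le_sum_of_subset (Finset.range_mono h)
  rw [Finset.sum_range_succ] at h2
  unfold rank
  omega

theorem rank_le_rank_iff (hL : ∀ n, 0 < L n) (x y : ℕ) : rank L x ≤ rank L y ↔
    block L x < block L y ∨ block L x = block L y ∧ offset L x ≤ offset L y := by
  rcases lt_trichotomy (block L x) (block L y) with h | h | h
  · simp [h, (rank_lt_of_block_lt hL h).le]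
  · simp [rank, h]
  · simp [h.not_gt, h.ne', (rank_lt_of_block_lt hL h).not_ge]

theorem rank_injective (hL : ∀ n, 0 < L n) : Function.Injective (rank L) := by
  intro x y h
  have h1 := (rank_le_rank_iff hL x y).1 h.le
  have h2 := (rank_le_rank_iff hL y x).1 h.ge
  have hb : block L x = block L y := by omega
  have ho : offset L x = offset L y := by omega
  suffices x = y ∨ x.unpair = y.unpair from
    this.elim id fun h => by rw [← Nat.pair_unpair x, h, Nat.pair_unpair]
  rw [Prod.ext_iff]
  unfold block at hb
  unfold offset at ho
  grind

theorem rank_zero : rank L (Nat.pair 0 0) = 0 := by simp [rank_pair]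

theorem rank_bijective (hL : ∀ n, 0 < L n) : Function.Bijective (rank L) := by
  refine ⟨rank_injective hL, fun k => ?_⟩
  induction k with
  | zero => exact ⟨_, rank_zero⟩
  | succ k ih =>
    obtain ⟨x, rfl⟩ := ih
    exact ⟨_, rank_next hL x⟩

theorem primrecPred_spare (hL : ∀ n, 0 < L n) (hLe : PrimrecRel fun n i => L n ≤ i) :
    PrimrecPred (Spare L) := by
  refine (hLe.comp (Primrec.fst.comp Primrec.unpair)
    (Primrec.pred.comp (Primrec.snd.comp Primrec.unpair))).of_eq fun x => ?_
  have := hL x.unpair.1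
  rw [Spare, Nat.pred_eq_sub_one]
  omega

theorem primrec_block (hL : ∀ n, 0 < L n) (hLe : PrimrecRel fun n i => L n ≤ i) :
    Primrec (block L) :=
  Primrec.ite (primrecPred_spare hL hLe) Primrec.id (Primrec.fst.comp Primrec.unpair)

theorem primrec_offset (hL : ∀ n, 0 < L n) (hLe : PrimrecRel fun n i => L n ≤ i) :
    Primrec (offset L) :=
  have hi := Primrec.snd.comp Primrec.unpair
  Primrec.ite (primrecPred_spare hL hLe) (Primrec.const 1) <|
    Primrec.ite (Primrec.eq.comp hi (Primrec.const 0)) (Primrec.const 0) <|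
      Primrec.nat_add.comp hi <|
        Primrec.ite ((primrecPred_spare hL hLe).comp (Primrec.fst.comp Primrec.unpair))
          (Primrec.const 1) (Primrec.const 0)

theorem primrec_next (hL : ∀ n, 0 < L n) (hLe : PrimrecRel fun n i => L n ≤ i) :
    Primrec (next L) :=
  have hn := Primrec.fst.comp Primrec.unpair
  have hi := Primrec.snd.comp Primrec.unpair
  have hs := primrecPred_spare hL hLe
  Primrec.ite hs (Primrec₂.natPair.comp Primrec.id (Primrec.const 1)) <|
    Primrec.ite ((Primrec.eq.comp hi (Primrec.const 0)).and (hs.comp hn)) hn <|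
      Primrec.ite (hLe.comp hn hi)
        (Primrec₂.natPair.comp (Primrec.succ.comp hn) (Primrec.const 0))
        (Primrec₂.natPair.comp hn (Primrec.succ.comp hi))

end SuccCopy

open SuccCopy in
theorem stmt_19 : ∃ c : ℕ ≃ ℕ,
    Primrec (fun x => c (c.symm x + 1)) ∧
    PrimrecRel (fun x y : ℕ => c.symm x ≤ c.symm y) ∧
    ¬ Primrec (fun x => c (Nat.pred (c.symm x))) := by
  obtain ⟨L, hL, hLe, hnot⟩ := exists_not_primrec_of_primrecRel_le
  let e : ℕ ≃ ℕ := Equiv.ofBijective (rank L) (rank_bijective hL)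
  have he : ∀ x, e x = rank L x := fun _ => rfl
  refine ⟨e.symm, ?_, ?_, fun h => hnot ?_⟩
  · refine (primrec_next hL hLe).of_eq fun x => ?_
    rw [Equiv.symm_symm, Equiv.eq_symm_apply, he, he, rank_next hL]
  · have hb := primrec_block hL hLe
    have ho := primrec_offset hL hLe
    have hb₁ := hb.comp (Primrec.fst (α := ℕ) (β := ℕ))
    have hb₂ := hb.comp (Primrec.snd (α := ℕ) (β := ℕ))
    have := (Primrec.nat_lt.comp hb₁ hb₂).or ((Primrec.eq.comp hb₁ hb₂).and
      (Primrec.nat_le.comp (ho.comp Primrec.fst) (ho.comp Primrec.snd)))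
    exact this.of_eq fun p => (rank_le_rank_iff hL p.1 p.2).symm
  · refine (Primrec.snd.comp (Primrec.unpair.comp (h.comp (Primrec₂.natPair.comp
      Primrec.succ (Primrec.const 0))))).of_eq fun n => ?_
    have hpred : e.symm (Nat.pred (e (Nat.pair (n + 1) 0))) = Nat.pair n (L n) := by
      rw [Equiv.symm_apply_eq, he, he, rank_pair (Nat.zero_le _), rank_pair le_rfl,
        Finset.sum_range_succ, size, if_neg (hL n).ne', if_pos rfl, Nat.pred_eq_sub_one]
      omega
    simp only [Equiv.symm_symm, Nat.succ_eq_add_one, hpred, Nat.unpair_pair]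
end
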